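/- arXiv:1110.5201 — 3 statements merged into one kernel-verified Lean document; each statement's English description precedes it below -/
import Mathlib

section
/- Let (X, d) be a compact metric space and T : X → X a continuous map with positive topological entropy h_top(T) > 0. Then there exists an uncountable set E ⊆ X such that every pair of distinct points x, y ∈ E is Li–Yorke scrambled, i.e., liminf_{n→∞} d(Tⁿx, Tⁿy) = 0 and limsup_{n→∞} d(Tⁿx, Tⁿy) > 0. -/
open Filter

def LYShat {Y ι : Type*} (A : ℕ → ι → Set Y) (S : Set Y) (J : Finset ℕ) : Prop :=
  ∀ σ : ℕ → ι, ∃ y ∈ S, ∀ j ∈ J, y ∈ A j (σ j)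

open Classical in
noncomputable def LYsh {Y ι : Type*} (A : ℕ → ι → Set Y) (S : Set Y) (D : Finset ℕ) :
    Finset (Finset ℕ) :=
  D.powerset.filter (LYShat A S)

lemma LYShat.mono {Y ι : Type*} {A : ℕ → ι → Set Y} {S S' : Set Y} {J : Finset ℕ}
    (h : LYShat A S J) (hS : S ⊆ S') : LYShat A S' J := fun σ => by
  obtain ⟨y, hy, h2⟩ := h σ
  exact ⟨y, hS hy, h2⟩

open Classical in
lemma LY_count {α ι : Type*} [Fintype ι] [Nonempty ι] (F : ι → Finset α) (U I : Finset α)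
    (hU : ∀ i, F i ⊆ U) (hI : ∀ a ∈ U, (∀ i, a ∈ F i) → a ∈ I) (m : ℕ)
    (hm : ∀ i, m ≤ (F i).card) :
    Fintype.card ι * m ≤ (Fintype.card ι - 1) * U.card + I.card := by
  have h1 : ∑ i, (F i).card = ∑ a ∈ U, (Finset.univ.filter (fun i => a ∈ F i)).card := by
    have := Finset.sum_card_bipartiteAbove_eq_sum_card_bipartiteBelow
      (s := (Finset.univ : Finset ι)) (t := U) (fun i a => a ∈ F i)
    simp only [Finset.bipartiteAbove, Finset.bipartiteBelow] at this
    rw [← this]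
    refine Finset.sum_congr rfl fun i _ => ?_
    congr 1
    ext a
    simp only [Finset.mem_filter]
    exact ⟨fun h => ⟨hU i h, h⟩, fun h => h.2⟩
  have h2 : Fintype.card ι * m ≤ ∑ i, (F i).card := by
    have := Finset.sum_le_sum (s := (Finset.univ : Finset ι)) (fun i _ => hm i)
    simpa using this
  have h3 : ∀ a ∈ U, (Finset.univ.filter (fun i => a ∈ F i)).card ≤
      (Fintype.card ι - 1) + if a ∈ I then 1 else 0 := by
    intro a ha
    by_cases h : ∀ i, a ∈ F i
    · rw [if_pos (hI a ha h)]
      have := Finset.card_le_univ (Finset.univ.filter (fun i => a ∈ F i))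
      have h0 : 0 < Fintype.card ι := Fintype.card_pos
      omega
    · push Not at h
      obtain ⟨i, hi⟩ := h
      have : (Finset.univ.filter (fun i => a ∈ F i)).card < (Finset.univ : Finset ι).card := by
        apply Finset.card_lt_card
        refine Finset.ssubset_univ_iff.2 fun h => hi ?_
        have := Finset.mem_univ i
        rw [← h] at this
        simpa using this
      rw [Finset.card_univ] at this
      omega
  have h4 := Finset.sum_le_sum h3
  have h5 : ∑ a ∈ U, (if a ∈ I then 1 else 0) ≤ I.card := by
    rw [← Finset.card_filter]
    exact Finset.card_le_card fun a ha => (Finset.mem_filter.1 ha).2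
  rw [Finset.sum_add_distrib, Finset.sum_const, smul_eq_mul] at h4
  rw [h1] at h2
  rw [mul_comm U.card] at h4
  omega

open Classical in
lemma LY_kl {Y ι : Type*} [Fintype ι] [Nontrivial ι] (A : ℕ → ι → Set Y)
    (hA : ∀ j a b, a ≠ b → Disjoint (A j a) (A j b)) (L : ℝ) (K : ℕ)
    (hL : 1 + (((Fintype.card ι : ℝ) - 1) / Fintype.card ι) ^ K ≤ L) (D : Finset ℕ) :
    ∀ S : Set Y, ∃ W : Finset (ℕ → ι),
      (W.card : ℝ) ≤ L ^ D.card * ((LYsh A S D).card : ℝ) ^ K ∧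
      ∀ y ∈ S, ∃ w ∈ W, ∀ j ∈ D, y ∉ A j (w j) := by
  have hk : 1 < Fintype.card ι := Fintype.one_lt_card
  have hkR : (1 : ℝ) < Fintype.card ι := by exact_mod_cast hk
  set q : ℝ := ((Fintype.card ι : ℝ) - 1) / Fintype.card ι with hq
  have hq0 : 0 ≤ q := div_nonneg (by linarith) (by linarith)
  have hL0 : 0 ≤ L := by have := pow_nonneg hq0 K; linarith
  induction D using Finset.induction_on with
  | empty =>
    intro S
    by_cases hS : S.Nonempty
    · refine ⟨{fun _ => Classical.arbitrary ι}, ?_, ?_⟩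
      · have : LYsh A S ∅ = {∅} := by
          ext J
          simp only [LYsh, Finset.mem_filter, Finset.mem_powerset, Finset.subset_empty,
            Finset.mem_singleton]
          constructor
          · exact fun h => h.1
          · rintro rfl
            exact ⟨rfl, fun σ => ⟨hS.some, hS.some_mem, by simp⟩⟩
        rw [this]
        simp
      · intro y hy
        exact ⟨_, Finset.mem_singleton_self _, by simp⟩
    · refine ⟨∅, ?_, fun y hy => (hS ⟨y, hy⟩).elim⟩
      simp
  | insert z D hz ih =>
    intro S
    obtain ⟨W0, hW0, hc0⟩ := ih S
    -- minimal symbol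
    obtain ⟨i, -, hi⟩ := Finset.exists_min_image (Finset.univ : Finset ι)
      (fun i => (LYsh A (S ∩ A z i) D).card) Finset.univ_nonempty
    obtain ⟨W1, hW1, hc1⟩ := ih (S ∩ A z i)
    obtain ⟨i', hi'⟩ := exists_ne i
    refine ⟨W0.image (fun w => Function.update w z i) ∪
      W1.image (fun w => Function.update w z i'), ?_, ?_⟩
    · set s := (LYsh A S (insert z D)).card with hs
      set m := (LYsh A (S ∩ A z i) D).card with hm
      have hcard : ((W0.image (fun w => Function.update w z i) ∪
        W1.image (fun w => Function.update w z i')).card : ℝ) ≤ W0.card + W1.card := by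
        have := Finset.card_union_le (W0.image (fun w => Function.update w z i))
          (W1.image (fun w => Function.update w z i'))
        have h1 := Finset.card_image_le (s := W0) (f := fun w => Function.update w z i)
        have h2 := Finset.card_image_le (s := W1) (f := fun w => Function.update w z i')
        exact_mod_cast this.trans (add_le_add h1 h2)
      set I := (LYsh A S D).filter (fun J => ∀ i, LYShat A (S ∩ A z i) J) with hI
      have hsum : (LYsh A S D).card + I.card ≤ s := by
        have hinj : Set.InjOn (fun J : Finset ℕ => insert z J) (I : Set (Finset ℕ)) := by
          intro J hJ J' hJ' h
          have hJ1 : J ⊆ D := by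
            have := hJ; simp [hI, LYsh] at this; exact this.1.1
          have hJ2 : J' ⊆ D := by
            have := hJ'; simp [hI, LYsh] at this; exact this.1.1
          have e1 := Finset.erase_insert (fun h => hz (hJ1 h))
          have e2 := Finset.erase_insert (fun h => hz (hJ2 h))
          simp only at h
          rw [← e1, ← e2, h]
        rw [← Finset.card_image_of_injOn hinj, ← Finset.card_union_of_disjoint]
        · apply Finset.card_le_card
          intro J hJ
          rw [Finset.mem_union] at hJ
          simp only [LYsh, Finset.mem_filter, Finset.mem_powerset] at hJ ⊢
          rcases hJ with hJ | hJ
          · exact ⟨hJ.1.trans (Finset.subset_insert _ _), hJ.2⟩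
          · obtain ⟨J0, hJ0, rfl⟩ := Finset.mem_image.1 hJ
            simp only [hI, LYsh, Finset.mem_filter, Finset.mem_powerset] at hJ0
            refine ⟨Finset.insert_subset_insert _ hJ0.1.1, fun σ => ?_⟩
            obtain ⟨y, hy, h2⟩ := hJ0.2 (σ z) σ
            refine ⟨y, hy.1, fun j hj => ?_⟩
            rcases Finset.mem_insert.1 hj with rfl | hj
            · exact hy.2
            · exact h2 j hj
        · rw [Finset.disjoint_left]
          intro J hJ hJ'
          obtain ⟨J0, hJ0, rfl⟩ := Finset.mem_image.1 hJ'
          simp only [LYsh, Finset.mem_filter, Finset.mem_powerset] at hJ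
          exact hz (hJ.1 (Finset.mem_insert_self _ _))
      have hcnt := LY_count (fun i => LYsh A (S ∩ A z i) D) (LYsh A S D) I
        (by
          intro i J hJ
          simp only [LYsh, Finset.mem_filter] at hJ ⊢
          exact ⟨hJ.1, hJ.2.mono Set.inter_subset_left⟩)
        (by
          intro J hJ h
          simp only [hI, Finset.mem_filter]
          refine ⟨hJ, fun i => ?_⟩
          have := h i
          simp only [LYsh, Finset.mem_filter] at this
          exact this.2) m (fun j => hi j (Finset.mem_univ _))
      have hms : (m : ℝ) ≤ q * s := by
        have : Fintype.card ι * m ≤ (Fintype.card ι - 1) * s := by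
          refine hcnt.trans ?_
          have h1 : 1 ≤ Fintype.card ι - 1 := by omega
          calc _ ≤ (Fintype.card ι - 1) * (LYsh A S D).card + (Fintype.card ι - 1) * I.card := by
                gcongr; exact Nat.le_mul_of_pos_left _ h1
            _ = (Fintype.card ι - 1) * ((LYsh A S D).card + I.card) := by ring
            _ ≤ _ := by gcongr
        have h2 : (Fintype.card ι : ℝ) * m ≤ ((Fintype.card ι : ℝ) - 1) * s := by
          have := (Nat.cast_le (α := ℝ)).2 this
          push_cast [Nat.cast_sub hk.le] at this
          exact this
        rw [hq, div_mul_eq_mul_div, le_div_iff₀ (by linarith)]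
        linarith
      have hMs : ((LYsh A S D).card : ℝ) ≤ s := by
        exact_mod_cast (Nat.le_add_right _ _).trans hsum
      rw [Finset.card_insert_of_notMem hz]
      have hs0 : (0 : ℝ) ≤ (s : ℝ) ^ K := by positivity
      calc _ ≤ (W0.card : ℝ) + W1.card := hcard
        _ ≤ L ^ D.card * (s : ℝ) ^ K + L ^ D.card * (q * s) ^ K := by
            refine add_le_add (hW0.trans ?_) (hW1.trans ?_) <;> gcongr
        _ = L ^ D.card * ((1 + q ^ K) * s ^ K) := by rw [mul_pow]; ring
        _ ≤ L ^ D.card * (L * s ^ K) := by gcongr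
        _ = _ := by ring
    · intro y hy
      by_cases hyi : y ∈ A z i
      · obtain ⟨w, hw, h⟩ := hc1 y ⟨hy, hyi⟩
        refine ⟨Function.update w z i', Finset.mem_union_right _ (Finset.mem_image_of_mem _ hw), ?_⟩
        intro j hj
        rcases Finset.mem_insert.1 hj with rfl | hj
        · simp only [Function.update_self]
          exact Set.disjoint_left.1 (hA _ _ _ hi'.symm) hyi
        · rw [Function.update_of_ne (fun h : j = z => hz (h ▸ hj))]
          exact h j hj
      · obtain ⟨w, hw, h⟩ := hc0 y hy
        refine ⟨Function.update w z i, Finset.mem_union_left _ (Finset.mem_image_of_mem _ hw), ?_⟩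
        intro j hj
        rcases Finset.mem_insert.1 hj with rfl | hj
        · simpa using hyi
        · rw [Function.update_of_ne (fun h : j = z => hz (h ▸ hj))]
          exact h j hj

def LYIndep {X ι : Type*} (T : X → X) (A : ι → Set X) (J : Finset ℕ) : Prop :=
  ∀ σ : ℕ → ι, ∃ x, ∀ j ∈ J, T^[j] x ∈ A (σ j)

def LYP {X ι : Type*} (T : X → X) (A : ι → Set X) : Prop :=
  ∃ c : ℝ, 0 < c ∧ ∃ᶠ n : ℕ in atTop, ∃ J ⊆ Finset.range n, c * n ≤ (J.card : ℝ) ∧ LYIndep T A J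

def LYCov {X ι : Type*} (T : X → X) (A : ι → Set X) (n : ℕ) (r : ℝ) : Prop :=
  ∃ W : Finset (ℕ → ι), (W.card : ℝ) ≤ r ∧ ∀ x, ∃ w ∈ W, ∀ j < n, T^[j] x ∉ A (w j)

def LYQ {X ι : Type*} (T : X → X) (A : ι → Set X) : Prop :=
  ∃ b : ℝ, 0 < b ∧ ∃ᶠ n : ℕ in atTop, ¬ LYCov T A n (Real.exp (b * n))

lemma LY_card_bound (F : Finset (Finset ℕ)) (n : ℕ) (hF : ∀ J ∈ F, J ⊆ Finset.range n)
    (t c : ℝ) (ht : 0 ≤ t) (hc : ∀ J ∈ F, (J.card : ℝ) ≤ c * n) :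
    (F.card : ℝ) ≤ Real.exp ((t * c + Real.exp (-t)) * n) := by
  have h1 : (F.card : ℝ) * Real.exp (-(t * c * n)) ≤ Real.exp (Real.exp (-t) * n) := by
    calc (F.card : ℝ) * Real.exp (-(t * c * n)) = ∑ J ∈ F, Real.exp (-(t * c * n)) := by simp
      _ ≤ ∑ J ∈ F, Real.exp (-t) ^ J.card := by
          refine Finset.sum_le_sum fun J hJ => ?_
          rw [← Real.exp_nat_mul]
          apply Real.exp_le_exp.2
          have := mul_le_mul_of_nonneg_left (hc J hJ) ht
          nlinarith
      _ ≤ ∑ J ∈ (Finset.range n).powerset, Real.exp (-t) ^ J.card := by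
          refine Finset.sum_le_sum_of_subset_of_nonneg
            (fun J hJ => Finset.mem_powerset.2 (hF J hJ)) (fun _ _ _ => by positivity)
      _ = (Real.exp (-t) + 1) ^ n := by
          have := Finset.sum_pow_mul_eq_add_pow (Real.exp (-t)) 1 (Finset.range n)
          simpa using this
      _ ≤ Real.exp (Real.exp (-t)) ^ n := by
          gcongr
          exact Real.add_one_le_exp _
      _ = _ := by rw [← Real.exp_nat_mul]; congr 1; ring
  rw [add_mul, Real.exp_add]
  rw [Real.exp_neg] at h1
  have := Real.exp_pos (t * c * n)
  rw [mul_inv_le_iff₀ this] at h1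
  linarith

lemma LYQ.toP {X ι : Type*} [Fintype ι] [Nontrivial ι] {T : X → X} {A : ι → Set X}
    (hA : ∀ a b, a ≠ b → Disjoint (A a) (A b)) (h : LYQ T A) : LYP T A := by
  obtain ⟨b, hb, hf⟩ := h
  have hk : 1 < Fintype.card ι := Fintype.one_lt_card
  have hkR : (1 : ℝ) < Fintype.card ι := by exact_mod_cast hk
  have hL1 : 0 < Real.exp (b / 4) - 1 := by
    have := Real.add_one_le_exp (b / 4); linarith
  obtain ⟨K, hK⟩ := exists_pow_lt_of_lt_one hL1
    (show ((Fintype.card ι : ℝ) - 1) / Fintype.card ι < 1 by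
      rw [div_lt_one (by linarith)]; linarith)
  obtain ⟨t, ht0, ht⟩ : ∃ t : ℝ, 0 ≤ t ∧ K * Real.exp (-t) ≤ b / 4 := by
    have h1 : Tendsto (fun t : ℝ => K * Real.exp (-t)) atTop (nhds (K * 0)) :=
      (Real.tendsto_exp_neg_atTop_nhds_zero).const_mul _
    rw [mul_zero] at h1
    have h2 := h1.eventually (ge_mem_nhds (show (0 : ℝ) < b / 4 by linarith))
    obtain ⟨t, h3, h4⟩ := (h2.and (eventually_ge_atTop 0)).exists
    exact ⟨t, h4, h3⟩
  have hden : 0 < 4 * ((K : ℝ) + 1) * (t + 1) := by positivity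
  set c : ℝ := b / (4 * ((K : ℝ) + 1) * (t + 1)) with hc
  have hc0 : 0 < c := div_pos hb hden
  have hKc : K * (t * c) ≤ b / 4 := by
    have : c * (4 * ((K : ℝ) + 1) * (t + 1)) = b := by rw [hc]; field_simp
    have hK0 : (0 : ℝ) ≤ K := Nat.cast_nonneg K
    have := mul_nonneg hc0.le hK0
    have := mul_nonneg hc0.le ht0
    nlinarith
  refine ⟨c, hc0, hf.mono fun n hn => ?_⟩
  by_contra hcon
  apply hn
  obtain ⟨W, hW, hcov⟩ := LY_kl (fun j a => {x : X | T^[j] x ∈ A a})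
    (fun j a b hab => Set.disjoint_left.2 fun x hx hx' =>
      Set.disjoint_left.1 (hA a b hab) hx hx') (Real.exp (b / 4)) K (by linarith)
    (Finset.range n) Set.univ
  refine ⟨W, hW.trans ?_, fun x => ?_⟩
  · have hcard := LY_card_bound (LYsh (fun j a => {x : X | T^[j] x ∈ A a}) Set.univ
      (Finset.range n)) n (by
        intro J hJ
        simp only [LYsh, Finset.mem_filter, Finset.mem_powerset] at hJ
        exact hJ.1) t c ht0 (by
        intro J hJ
        simp only [LYsh, Finset.mem_filter, Finset.mem_powerset] at hJ
        by_contra hlt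
        push Not at hlt
        refine hcon ⟨J, hJ.1, hlt.le, fun σ => ?_⟩
        obtain ⟨x, -, hx⟩ := hJ.2 σ
        exact ⟨x, hx⟩)
    rw [Finset.card_range]
    calc _ ≤ Real.exp (b / 4) ^ n * (Real.exp ((t * c + Real.exp (-t)) * n)) ^ K := by gcongr
      _ = Real.exp (n * (b / 4) + K * ((t * c + Real.exp (-t)) * n)) := by
          rw [Real.exp_add, Real.exp_nat_mul, Real.exp_nat_mul]
      _ ≤ _ := by
          apply Real.exp_le_exp.2
          have hn0 : (0 : ℝ) ≤ n := Nat.cast_nonneg n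
          nlinarith [mul_nonneg hb.le hn0, mul_le_mul_of_nonneg_right ht hn0,
            mul_le_mul_of_nonneg_right hKc hn0]
  · obtain ⟨w, hw, h⟩ := hcov x trivial
    exact ⟨w, hw, fun j hj => h j (Finset.mem_range.2 hj)⟩

open Classical in
lemma LYP.toQ {X ι : Type*} [Fintype ι] [Nontrivial ι] {T : X → X} {A : ι → Set X}
    (h : LYP T A) : LYQ T A := by
  obtain ⟨c, hc, hf⟩ := h
  have hk : 1 < Fintype.card ι := Fintype.one_lt_card
  have hkR : (1 : ℝ) < Fintype.card ι := by exact_mod_cast hk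
  refine ⟨c / Fintype.card ι, by positivity, (hf.and_eventually (eventually_gt_atTop 0)).mono ?_⟩
  rintro n ⟨⟨J, hJn, hJ, hI⟩, hn⟩ ⟨W, hW, hcov⟩
  have hn0 : (0 : ℝ) < n := by exact_mod_cast hn
  have hJ0 : J.card ≠ 0 := by
    intro h0
    rw [h0] at hJ
    have := mul_pos hc hn0
    simp at hJ
    linarith
  -- functions J → ι
  have hchoose : ∀ σ : (J → ι), ∃ x, ∀ j : J, T^[(j : ℕ)] x ∈ A (σ j) := by
    intro σ
    obtain ⟨x, hx⟩ := hI (fun j => if h : j ∈ J then σ ⟨j, h⟩ else Classical.arbitrary ι)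
    refine ⟨x, fun j => ?_⟩
    have := hx j j.2
    simpa using this
  choose x hx using hchoose
  have hcover : (Finset.univ : Finset (J → ι)) ⊆
      W.biUnion (fun w => Fintype.piFinset (fun j : J => Finset.univ.erase (w j))) := by
    intro σ _
    obtain ⟨w, hw, hwx⟩ := hcov (x σ)
    refine Finset.mem_biUnion.2 ⟨w, hw, Fintype.mem_piFinset.2 fun j => ?_⟩
    refine Finset.mem_erase.2 ⟨fun h => ?_, Finset.mem_univ _⟩
    refine hwx j (Finset.mem_range.1 (hJn j.2)) ?_
    rw [← h]
    exact hx σ j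
  have h1 := (Finset.card_le_card hcover).trans Finset.card_biUnion_le
  simp only [Finset.card_univ, Fintype.card_fun, Fintype.card_piFinset, Fintype.card_coe,
    Finset.card_erase_of_mem (Finset.mem_univ _), Finset.prod_const, Finset.sum_const,
    smul_eq_mul] at h1
  have h2 : (Fintype.card ι : ℝ) ^ J.card ≤ W.card * ((Fintype.card ι : ℝ) - 1) ^ J.card := by
    have := (Nat.cast_le (α := ℝ)).2 h1
    push_cast [Nat.cast_sub hk.le] at this
    exact this
  set k : ℝ := ((Fintype.card ι : ℕ) : ℝ) with hkdef
  have h3 : (W.card : ℝ) ≤ Real.exp (1 / k) ^ J.card := by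
    refine hW.trans ?_
    rw [← Real.exp_nat_mul]
    apply Real.exp_le_exp.2
    rw [div_mul_eq_mul_div, mul_one_div]
    gcongr
  have h4 : Real.exp (1 / k) * (k - 1) < k := by
    have h5 : -(1 / k) + 1 < Real.exp (-(1 / k)) :=
      Real.add_one_lt_exp (by simp; linarith)
    rw [Real.exp_neg, lt_inv_comm₀ (by
      have : 1 / k < 1 := by rw [div_lt_one (by linarith)]; exact hkR
      linarith) (Real.exp_pos _)] at h5
    have h6 : (-(1 / k) + 1) = (k - 1) / k := by field_simp; ring
    rw [h6, inv_div, lt_div_iff₀ (by linarith)] at h5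
    exact h5
  have h7 : (Real.exp (1 / k) * (k - 1)) ^ J.card < k ^ J.card :=
    pow_lt_pow_left₀ h4 (mul_nonneg (Real.exp_pos _).le (by linarith)) hJ0
  rw [mul_pow] at h7
  have h8 : (W.card : ℝ) * (k - 1) ^ J.card ≤ Real.exp (1 / k) ^ J.card * (k - 1) ^ J.card := by
    have : (0 : ℝ) ≤ (k - 1) ^ J.card := pow_nonneg (by linarith) _
    gcongr
  linarith

lemma LYP.reindex {X ι κ : Type*} {T : X → X} {A : ι → Set X} {B : κ → Set X} (f : κ → ι)
    (hB : ∀ u, A (f u) ⊆ B u) (h : LYP T A) : LYP T B := by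
  obtain ⟨c, hc, hf⟩ := h
  refine ⟨c, hc, hf.mono ?_⟩
  rintro n ⟨J, hJ, h1, h2⟩
  refine ⟨J, hJ, h1, fun σ => ?_⟩
  obtain ⟨x, hx⟩ := h2 (fun j => f (σ j))
  exact ⟨x, fun j hj => hB _ (hx j hj)⟩

open Classical in
lemma LYP.shrink {X ι κ : Type*} [DecidableEq ι] [Fintype ι] [Nontrivial ι] [Fintype κ]
    {T : X → X} {A : ι → Set X}
    (hA : ∀ a b, a ≠ b → Disjoint (A a) (A b)) (h : LYP T A) (a0 : ι) (B : κ → Set X)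
    (hB : A a0 ⊆ ⋃ i, B i) : ∃ i, LYP T (Function.update A a0 (A a0 ∩ B i)) := by
  suffices h : ∃ i, LYQ T (Function.update A a0 (A a0 ∩ B i)) by
    obtain ⟨i, hi⟩ := h
    refine ⟨i, hi.toP fun a b hab => ?_⟩
    have hsub : ∀ a, Function.update A a0 (A a0 ∩ B i) a ⊆ A a := by
      intro a
      by_cases ha : a = a0
      · subst ha; simp
      · rw [Function.update_of_ne ha]
    exact (hA a b hab).mono (hsub a) (hsub b)
  by_contra hcon
  obtain ⟨b, hb, hf⟩ := h.toQ
  refine hf ?_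
  have hr : (0 : ℝ) < (Fintype.card κ : ℝ) + 1 := by positivity
  have hall : ∀ i, ∀ᶠ n : ℕ in atTop, LYCov T (Function.update A a0 (A a0 ∩ B i)) n
      (Real.exp (b / ((Fintype.card κ : ℝ) + 1) * n)) := by
    intro i
    by_contra h
    refine hcon ⟨i, _, div_pos hb hr, ?_⟩
    rw [Filter.not_eventually] at h
    exact h
  refine (Filter.eventually_all.2 hall).mono fun n hn => ?_
  simp only [not_not]
  choose W hW hcov using hn
  refine ⟨(Fintype.piFinset W).image (fun w j =>
    if h : ∃ i, w i j ≠ a0 then w h.choose j else a0), ?_, ?_⟩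
  · calc _ ≤ ((Fintype.piFinset W).card : ℝ) := by exact_mod_cast Finset.card_image_le
      _ = ∏ i, ((W i).card : ℝ) := by rw [Fintype.card_piFinset]; push_cast; rfl
      _ ≤ ∏ i : κ, Real.exp (b / ((Fintype.card κ : ℝ) + 1) * n) :=
          Finset.prod_le_prod (fun _ _ => by positivity) (fun i _ => hW i)
      _ = Real.exp (Fintype.card κ * (b / ((Fintype.card κ : ℝ) + 1) * n)) := by
          rw [Finset.prod_const, Finset.card_univ, Real.exp_nat_mul]
      _ ≤ _ := by
          apply Real.exp_le_exp.2
          rw [← mul_assoc]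
          gcongr
          rw [← mul_div_assoc, div_le_iff₀ hr]
          nlinarith
  · intro x
    choose w hw hwx using fun i => hcov i x
    refine ⟨_, Finset.mem_image_of_mem _ (Fintype.mem_piFinset.2 hw), fun j hj => ?_⟩
    split_ifs with h
    · have := hwx h.choose j hj
      rwa [Function.update_of_ne h.choose_spec] at this
    · push Not at h
      intro hx
      obtain ⟨i, hi⟩ := Set.mem_iUnion.1 (hB hx)
      have := hwx i j hj
      rw [h i, Function.update_self] at this
      exact this ⟨hx, hi⟩

lemma LY_bad (J : Finset ℕ) (n M D : ℕ) (hJ : J ⊆ Finset.range n) (hD : 0 < D)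
    (hbad : ∀ j ∈ J, ∀ m, M ≤ m → m ≤ D → j + m ∉ J) : J.card ≤ M * (n / D + 1) := by
  have h1 : J.card ≤ M * (J.image (fun j => j / D)).card := by
    refine Finset.card_le_mul_card_image J M fun q _ => ?_
    by_cases hne : (J.filter (fun j => j / D = q)).Nonempty
    · set a := (J.filter (fun j => j / D = q)).min' hne with ha
      have ham := Finset.min'_mem _ hne
      rw [← ha, Finset.mem_filter] at ham
      have hsub : J.filter (fun j => j / D = q) ⊆ Finset.Ico a (a + M) := by
        intro j hj
        have hle : a ≤ j := Finset.min'_le _ _ hj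
        rw [Finset.mem_filter] at hj
        rw [Finset.mem_Ico]
        refine ⟨hle, ?_⟩
        by_contra hge
        push Not at hge
        refine hbad a ham.1 (j - a) (by omega) ?_ (by rw [Nat.add_sub_cancel' hle]; exact hj.1)
        have e1 := Nat.div_add_mod j D
        have e2 := Nat.div_add_mod a D
        have e3 := Nat.mod_lt j hD
        rw [hj.2] at e1
        rw [ham.2] at e2
        omega
      simpa using Finset.card_le_card hsub
    · rw [Finset.not_nonempty_iff_eq_empty.1 hne]; simp
  refine h1.trans (Nat.mul_le_mul_left _ ?_)
  have : J.image (fun j => j / D) ⊆ Finset.range (n / D + 1) := by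
    intro q hq
    obtain ⟨j, hj, rfl⟩ := Finset.mem_image.1 hq
    have := Finset.mem_range.1 (hJ hj)
    exact Finset.mem_range.2 (Nat.lt_succ_of_le (Nat.div_le_div_right this.le))
  simpa using Finset.card_le_card this

lemma LY_gap (c : ℝ) (hc : 0 < c) (M : ℕ) (hM : 0 < M) : ∃ c' : ℝ, 0 < c' ∧ ∃ D N : ℕ,
    ∀ n ≥ N, ∀ J ⊆ Finset.range n, c * n ≤ (J.card : ℝ) →
      ∃ m ∈ Finset.Icc M D, ∃ J' ⊆ J, c' * n ≤ (J'.card : ℝ) ∧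
        ∀ j ∈ J', j + m ∈ J ∧ j + m ∉ J' := by
  obtain ⟨D, hD⟩ := exists_nat_ge (4 * M / c + M)
  have hMR : (0 : ℝ) < M := by exact_mod_cast hM
  have hDM : (M : ℝ) ≤ D := by
    have : (0 : ℝ) ≤ 4 * M / c := by positivity
    linarith
  have hD0 : (0 : ℝ) < D := by linarith
  have hDM' : M ≤ D := by exact_mod_cast hDM
  have hDc : 4 * M ≤ c * D := by
    have : 4 * M / c ≤ D := by linarith
    rw [div_le_iff₀ hc] at this
    linarith
  obtain ⟨N, hN⟩ := exists_nat_ge (4 * M / c)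
  refine ⟨c / (4 * (D + 1)), by positivity, D, N, fun n hn J hJ hcard => ?_⟩
  have hnN : 4 * M ≤ c * n := by
    have : 4 * M / c ≤ n := hN.trans (by exact_mod_cast hn)
    rw [div_le_iff₀ hc] at this
    linarith
  classical
  set G : ℕ → Finset ℕ := fun m => J.filter (fun j => j + m ∈ J) with hG
  set Bd := J.filter (fun j => ∀ m, M ≤ m → m ≤ D → j + m ∉ J) with hBd
  have hbadcard := LY_bad Bd n M D ((Finset.filter_subset _ _).trans hJ) (by omega) (by
    intro j hj m h1 h2 h3
    exact (Finset.mem_filter.1 hj).2 m h1 h2 (Finset.mem_filter.1 h3).1)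
  have hbadR : (Bd.card : ℝ) ≤ c * n / 2 := by
    have h1 : (Bd.card : ℝ) ≤ M * ((n / D : ℕ) + 1) := by exact_mod_cast hbadcard
    have h2 : ((n / D : ℕ) : ℝ) ≤ (n : ℝ) / D := Nat.cast_div_le
    have h3 : (M : ℝ) * ((n : ℝ) / D) ≤ c * n / 4 := by
      rw [← mul_div_assoc, div_le_iff₀ hD0]
      have hn0 : (0 : ℝ) ≤ n := Nat.cast_nonneg n
      nlinarith [mul_le_mul_of_nonneg_right hDc hn0]
    nlinarith
  have hJsub : J ⊆ Bd ∪ (Finset.Icc M D).biUnion G := by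
    intro j hj
    by_cases h : ∀ m, M ≤ m → m ≤ D → j + m ∉ J
    · exact Finset.mem_union_left _ (Finset.mem_filter.2 ⟨hj, h⟩)
    · push Not at h
      obtain ⟨m, h1, h2, h3⟩ := h
      exact Finset.mem_union_right _ (Finset.mem_biUnion.2
        ⟨m, Finset.mem_Icc.2 ⟨h1, h2⟩, Finset.mem_filter.2 ⟨hj, h3⟩⟩)
  have hsum : c * n / 2 ≤ ∑ m ∈ Finset.Icc M D, ((G m).card : ℝ) := by
    have h1 := (Finset.card_le_card hJsub).trans (Finset.card_union_le _ _)
    have h2 : ((Finset.Icc M D).biUnion G).card ≤ ∑ m ∈ Finset.Icc M D, (G m).card :=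
      Finset.card_biUnion_le
    have h3 : (J.card : ℝ) ≤ Bd.card + ∑ m ∈ Finset.Icc M D, ((G m).card : ℝ) := by
      exact_mod_cast h1.trans (Nat.add_le_add_left h2 _)
    linarith
  obtain ⟨m, hm, hGm⟩ : ∃ m ∈ Finset.Icc M D, c * n / (2 * (D + 1)) ≤ ((G m).card : ℝ) := by
    by_contra hcon
    push Not at hcon
    have hlt := Finset.sum_lt_sum_of_nonempty
      (Finset.nonempty_Icc.2 hDM') hcon
    rw [Finset.sum_const, Nat.card_Icc, nsmul_eq_mul] at hlt
    have h5 : ((D + 1 - M : ℕ) : ℝ) ≤ D + 1 := by exact_mod_cast Nat.sub_le _ _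
    have h6 : ((D + 1 - M : ℕ) : ℝ) * (c * n / (2 * (D + 1))) ≤ (D + 1) * (c * n / (2 * (D + 1))) := by
      gcongr
    have h7 : ((D : ℝ) + 1) * (c * n / (2 * (D + 1))) = c * n / 2 := by field_simp
    linarith
  have hm1 := Finset.mem_Icc.1 hm
  have hmpos : 0 < m := by omega
  have hpar : ∀ j, (j + m) / m = j / m + 1 := fun j => Nat.add_div_right j hmpos
  have hsplit := Finset.card_filter_add_card_filter_not (s := G m) (fun j => j / m % 2 = 0)
  have hsplitR : (((G m).filter (fun j => j / m % 2 = 0)).card : ℝ) +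
    ((G m).filter (fun j => ¬ j / m % 2 = 0)).card = (G m).card := by exact_mod_cast hsplit
  have hce : c / (4 * (D + 1)) * n = (c * n / (2 * (D + 1))) / 2 := by field_simp; ring
  rcases le_total (((G m).filter (fun j => j / m % 2 = 0)).card : ℝ)
    (((G m).filter (fun j => ¬ j / m % 2 = 0)).card : ℝ) with hle | hle
  · refine ⟨m, hm, (G m).filter (fun j => ¬ j / m % 2 = 0),
      (Finset.filter_subset _ _).trans (Finset.filter_subset _ _), by linarith, ?_⟩
    intro j hj
    rw [Finset.mem_filter] at hj
    refine ⟨(Finset.mem_filter.1 hj.1).2, fun h => ?_⟩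
    have := (Finset.mem_filter.1 h).2
    rw [hpar] at this
    omega
  · refine ⟨m, hm, (G m).filter (fun j => j / m % 2 = 0),
      (Finset.filter_subset _ _).trans (Finset.filter_subset _ _), by linarith, ?_⟩
    intro j hj
    rw [Finset.mem_filter] at hj
    refine ⟨(Finset.mem_filter.1 hj.1).2, fun h => ?_⟩
    have := (Finset.mem_filter.1 h).2
    rw [hpar] at this
    omega

open Classical in
lemma LYP.pair {X ι : Type*} {T : X → X} {A : ι → Set X} (h : LYP T A) (M : ℕ) :
    ∃ m ≥ M, LYP T (fun p : ι × ι => A p.1 ∩ T^[m] ⁻¹' (A p.2)) := by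
  obtain ⟨c, hc, hf⟩ := h
  obtain ⟨c', hc', D, N, hgap⟩ := LY_gap c hc (M + 1) (Nat.succ_pos _)
  by_contra hcon
  have hall : ∀ m ∈ Finset.Icc (M + 1) D, ∀ᶠ n : ℕ in atTop,
      ¬ ∃ J ⊆ Finset.range n, c' * n ≤ (J.card : ℝ) ∧
        LYIndep T (fun p : ι × ι => A p.1 ∩ T^[m] ⁻¹' (A p.2)) J := by
    intro m hm
    by_contra h
    refine hcon ⟨m, by have := (Finset.mem_Icc.1 hm).1; omega, c', hc', ?_⟩
    rw [Filter.not_eventually] at h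
    simpa only [not_not] using h
  have hall' := (Filter.eventually_all_finset _).2 hall
  obtain ⟨n, ⟨⟨J, hJ, hcard, hI⟩, hno⟩, hnN⟩ :=
    ((hf.and_eventually hall').and_eventually (eventually_ge_atTop N)).exists
  obtain ⟨m, hm, J', hJ', hcard', hj⟩ := hgap n hnN J hJ hcard
  refine hno m hm ⟨J', hJ'.trans hJ, hcard', fun σ => ?_⟩
  obtain ⟨x, hx⟩ := hI (fun i => if i ∈ J' then (σ i).1 else (σ (i - m)).2)
  refine ⟨x, fun j hjJ => ⟨?_, ?_⟩⟩
  · have := hx j (hJ' hjJ)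
    rwa [if_pos hjJ] at this
  · have := hx (j + m) (hj j hjJ).1
    rw [if_neg (hj j hjJ).2, Nat.add_sub_cancel, add_comm, Function.iterate_add_apply] at this
    exact this

lemma LY_start {X : Type*} [MetricSpace X] [CompactSpace X]
    (T : X → X) (hent : 0 < Dynamics.coverEntropy T (Set.univ : Set X)) :
    ∃ p : X, ∃ ε : ℝ, 0 < ε ∧ LYQ T (fun b : Bool =>
      if b then Metric.closedBall p (ε / 4) else (Metric.ball p (ε / 2))ᶜ) := by
  classical
  by_contra hcon
  push Not at hcon
  refine absurd hent (not_lt.2 ?_)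
  unfold Dynamics.coverEntropy
  refine iSup₂_le fun U hU => ?_
  obtain ⟨ε, hε, hεU⟩ := Metric.mem_uniformity_dist.1 hU
  unfold Dynamics.coverEntropyEntourage
  refine ExpGrowth.expGrowthSup_le_iff.2 fun b hb => ?_
  obtain ⟨r, hr0, hrb⟩ := EReal.lt_iff_exists_real_btwn.1 hb
  have hr : 0 < r := by exact_mod_cast hr0
  obtain ⟨t, -, htf, ht⟩ := IsCompact.finite_cover_balls (isCompact_univ (X := X))
    (show (0 : ℝ) < ε / 4 by linarith)
  have : Fintype t := htf.fintype
  have hk : (0 : ℝ) < (Fintype.card t : ℝ) + 1 := by positivity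
  have hall : ∀ p : t, ∀ᶠ n : ℕ in atTop, LYCov T (fun b : Bool =>
      if b then Metric.closedBall (p : X) (ε / 4) else (Metric.ball (p : X) (ε / 2))ᶜ) n
      (Real.exp (r / ((Fintype.card t : ℝ) + 1) * n)) := by
    intro p
    by_contra h
    refine hcon p ε hε ⟨_, div_pos hr hk, ?_⟩
    rw [Filter.not_eventually] at h
    exact h
  refine (Filter.eventually_all.2 hall).mono fun n hn => ?_
  choose W hW hcov using hn
  -- cells
  set C : (t → ℕ → Bool) → Set X := fun w => {x | ∀ p : t, ∀ j < n,
    T^[j] x ∉ (if w p j then Metric.closedBall (p : X) (ε / 4) else (Metric.ball (p : X) (ε / 2))ᶜ)}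
    with hC
  set s : Finset X := ((Fintype.piFinset W).filter (fun w => (C w).Nonempty)).attach.image
    (fun w => (Finset.mem_filter.1 w.2).2.some) with hs
  have hcard : (s.card : ℝ) ≤ Real.exp (r * n) := by
    calc _ ≤ ((Fintype.piFinset W).card : ℝ) := by
          have h1 : s.card ≤ _ := Finset.card_image_le
          rw [Finset.card_attach] at h1
          exact_mod_cast h1.trans (Finset.card_filter_le _ _)
      _ = ∏ i, ((W i).card : ℝ) := by rw [Fintype.card_piFinset]; push_cast; rfl
      _ ≤ ∏ i : t, Real.exp (r / ((Fintype.card t : ℝ) + 1) * n) :=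
          Finset.prod_le_prod (fun _ _ => by positivity) (fun i _ => hW i)
      _ = Real.exp (Fintype.card t * (r / ((Fintype.card t : ℝ) + 1) * n)) := by
          rw [Finset.prod_const, Finset.card_univ, Real.exp_nat_mul]
      _ ≤ _ := by
          apply Real.exp_le_exp.2
          rw [← mul_assoc]
          gcongr
          rw [← mul_div_assoc, div_le_iff₀ hk]
          nlinarith
  have hcover : Dynamics.IsDynCoverOf T Set.univ U n (s : Set X) := by
    intro x _
    choose w hw hwx using fun p => hcov p x
    have hxC : x ∈ C w := fun p j hj => hwx p j hj
    have hmem : w ∈ (Fintype.piFinset W).filter (fun w => (C w).Nonempty) :=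
      Finset.mem_filter.2 ⟨Fintype.mem_piFinset.2 hw, ⟨x, hxC⟩⟩
    refine ⟨(Finset.mem_filter.1 hmem).2.some, ?_, ?_⟩
    · rw [hs, Finset.mem_coe, Finset.mem_image]
      exact ⟨⟨w, hmem⟩, Finset.mem_attach _ _, rfl⟩
    · have hy := (Finset.mem_filter.1 hmem).2.some_mem
      generalize (Finset.mem_filter.1 hmem).2.some = y at hy
      refine Dynamics.mem_dynEntourage.2 fun j hj => hεU ?_
      have hxt := ht (Set.mem_univ (T^[j] x))
      simp only [Set.mem_iUnion, Metric.mem_ball] at hxt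
      obtain ⟨p, hp, hxp⟩ := hxt
      have h1 := hxC ⟨p, hp⟩ j hj
      have h2 := hy ⟨p, hp⟩ j hj
      have hwf : w ⟨p, hp⟩ j = false := by
        by_contra h
        rw [Bool.not_eq_false] at h
        rw [h, if_pos rfl] at h1
        exact h1 (Metric.mem_closedBall.2 hxp.le)
      rw [hwf] at h2
      simp only [Bool.false_eq_true, if_false, Set.mem_compl_iff, Metric.mem_ball, not_not] at h2
      have := dist_triangle_right (T^[j] x) (T^[j] y) p
      linarith
  have h1 := hcover.coverMincard_le_card
  calc ((Dynamics.coverMincard T Set.univ U n : ℕ∞) : ENNReal) ≤ ((s.card : ℕ∞) : ENNReal) :=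
        ENat.toENNReal_mono h1
    _ = ENNReal.ofReal (s.card : ℝ) := by simp
    _ ≤ ENNReal.ofReal (Real.exp (r * n)) := ENNReal.ofReal_le_ofReal hcard
    _ = EReal.exp ((r * n : ℝ) : EReal) := (EReal.exp_coe _).symm
    _ ≤ EReal.exp (b * n) := by
        apply EReal.exp_monotone
        rw [EReal.coe_mul]
        exact mul_le_mul_of_nonneg_right hrb.le (by positivity)

structure LYGood {X : Type*} [TopologicalSpace X] (T : X → X) (Q : Bool → Set X) (n : ℕ)
    (A : (Fin (n + 1) → Bool) → Set X) : Prop where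
  closed : ∀ u, IsClosed (A u)
  sub : ∀ u, A u ⊆ Q (u 0)
  disj : ∀ u v, u ≠ v → Disjoint (A u) (A v)
  pos : LYP T A

lemma LY_step {X : Type*} [MetricSpace X] [CompactSpace X]
    (T : X → X) (hT : Continuous T) (Q : Bool → Set X) (n : ℕ)
    (A : (Fin (n + 1) → Bool) → Set X) (hA : LYGood T Q n A) (i : Fin (n + 2)) (ε : ℝ)
    (hε : 0 < ε) : ∃ A' : (Fin (n + 2) → Bool) → Set X, LYGood T Q (n + 1) A' ∧
      (∀ u, A' u ⊆ A (fun j => u j.castSucc)) ∧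
      (∃ m ≥ n, ∀ u, ∀ x ∈ A' u, T^[m] x ∈ Q (u i)) ∧
      (∃ m ≥ n, ∀ u v, ∀ x ∈ A' u, ∀ y ∈ A' v, dist (T^[m] x) (T^[m] y) ≤ ε) := by
  classical
  obtain ⟨m1, -, h1⟩ := hA.pos.pair n
  set A1 : (Fin (n + 2) → Bool) → Set X := fun u =>
    A (fun j => u j.castSucc) ∩ T^[m1] ⁻¹' (A (fun _ => u (Fin.last _))) with hA1
  have hP1 : LYP T A1 := h1.reindex (fun u => (fun j => u j.castSucc, fun _ => u (Fin.last _)))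
    (fun u => subset_rfl)
  have hc1 : ∀ u, IsClosed (A1 u) := fun u =>
    (hA.closed _).inter ((hA.closed _).preimage (hT.iterate _))
  have hd1 : ∀ u v, u ≠ v → Disjoint (A1 u) (A1 v) := by
    intro u v huv
    rw [Set.disjoint_left]
    rintro x ⟨hx1, hx2⟩ ⟨hy1, hy2⟩
    apply huv
    have e1 : (fun j : Fin (n + 1) => u j.castSucc) = (fun j => v j.castSucc) := by
      by_contra h
      exact Set.disjoint_left.1 (hA.disj _ _ h) hx1 hy1
    have e2 : (fun _ : Fin (n + 1) => u (Fin.last _)) = (fun _ => v (Fin.last _)) := by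
      by_contra h
      exact Set.disjoint_left.1 (hA.disj _ _ h) hx2 hy2
    funext j
    refine Fin.lastCases ?_ (fun j => ?_) j
    · exact congrFun e2 0
    · exact congrFun e1 j
  obtain ⟨t, -, htf, ht⟩ := IsCompact.finite_cover_balls (isCompact_univ (X := X))
    (show (0 : ℝ) < ε / 2 by linarith)
  have : Fintype t := htf.fintype
  obtain ⟨p, hP2⟩ := hP1.shrink hd1 (fun _ => false)
    (fun p : t => Metric.closedBall (p : X) (ε / 2)) (by
      intro x _
      have := ht (Set.mem_univ x)
      simp only [Set.mem_iUnion] at this ⊢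
      obtain ⟨p, hp, hx⟩ := this
      exact ⟨⟨p, hp⟩, Metric.ball_subset_closedBall hx⟩)
  set A2 := Function.update A1 (fun _ => false)
    (A1 (fun _ => false) ∩ Metric.closedBall (p : X) (ε / 2)) with hA2
  have hs2 : ∀ u, A2 u ⊆ A1 u := by
    intro u
    by_cases hu : u = fun _ => false
    · subst hu; simp [hA2]
    · rw [hA2, Function.update_of_ne hu]
  have hc2 : ∀ u, IsClosed (A2 u) := by
    intro u
    by_cases hu : u = fun _ => false
    · subst hu
      rw [hA2, Function.update_self]
      exact IsClosed.inter (hc1 (fun _ => false)) Metric.isClosed_closedBall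
    · rw [hA2, Function.update_of_ne hu]
      exact hc1 u
  have hb2 : A2 (fun _ => false) ⊆ Metric.closedBall (p : X) (ε / 2) := by
    rw [hA2, Function.update_self]
    exact Set.inter_subset_right
  obtain ⟨m2, hm2, h2⟩ := hP2.pair n
  set A3 : (Fin (n + 2) → Bool) → Set X := fun u =>
    A2 u ∩ T^[m2] ⁻¹' (A2 (fun _ => false)) with hA3
  have hP3 : LYP T A3 := h2.reindex (fun u => (u, fun _ => false)) (fun u => subset_rfl)
  obtain ⟨m3, hm3, h3⟩ := hP3.pair n
  have hP4 : LYP T (fun u => A3 u ∩ T^[m3] ⁻¹' (A3 (fun _ => u i))) :=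
    h3.reindex (fun u => (u, fun _ => u i)) (fun u => subset_rfl)
  have hs4 : ∀ u, A3 u ∩ T^[m3] ⁻¹' (A3 (fun _ => u i)) ⊆ A1 u := fun u x hx => hs2 u hx.1.1
  have hs0 : ∀ u, A1 u ⊆ Q (u 0) := fun u x hx => hA.sub _ hx.1
  refine ⟨_, ⟨?_, ?_, ?_, hP4⟩, ?_, ⟨m3, hm3, ?_⟩, ⟨m2, hm2, ?_⟩⟩
  · intro u
    have hc3 : ∀ u, IsClosed (A3 u) := fun u => (hc2 _).inter ((hc2 _).preimage (hT.iterate _))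
    exact (hc3 _).inter ((hc3 _).preimage (hT.iterate _))
  · exact fun u => (hs4 u).trans (hs0 u)
  · exact fun u v huv => (hd1 u v huv).mono (hs4 u) (hs4 v)
  · exact fun u x hx => (hs4 u hx).1
  · exact fun u x hx => hs0 _ (hs2 _ hx.2.1)
  · intro u v x hx y hy
    have e1 := Metric.mem_closedBall.1 (hb2 hx.1.2)
    have e2 := Metric.mem_closedBall.1 (hb2 hy.1.2)
    have := dist_triangle_right (T^[m2] x) (T^[m2] y) p
    linarith

lemma LYP.nonempty {X ι : Type*} {T : X → X} {A : ι → Set X} (h : LYP T A) (u : ι) :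
    (A u).Nonempty := by
  obtain ⟨c, hc, hf⟩ := h
  obtain ⟨n, ⟨J, -, hJ, hI⟩, hn⟩ := (hf.and_eventually (eventually_gt_atTop 0)).exists
  have hn0 : (0 : ℝ) < n := by exact_mod_cast hn
  have hJ0 : 0 < J.card := by
    have := mul_pos hc hn0
    exact_mod_cast this.trans_le hJ
  obtain ⟨j, hj⟩ := Finset.card_pos.1 hJ0
  obtain ⟨x, hx⟩ := hI (fun _ => u)
  exact ⟨_, hx j hj⟩


/-- **Positive topological entropy implies Li–Yorke chaos.** If `T` is a continuous self-map of
a compact metric space with positive topological entropy, then there is an uncountable set `E`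
such that every pair of distinct points `x, y ∈ E` is Li–Yorke scrambled：
`liminf dist (T^[n] x) (T^[n] y) = 0` and `limsup dist (T^[n] x) (T^[n] y) > 0`. -/
theorem positive_entropy_implies_LiYorke {X : Type*} [MetricSpace X] [CompactSpace X]
    (T : X → X) (hT : Continuous T)
    (hent : 0 < Dynamics.coverEntropy T (Set.univ : Set X)) :
    ∃ E : Set X, ¬ E.Countable ∧
      ∀ x ∈ E, ∀ y ∈ E, x ≠ y →
        Filter.liminf (fun n : ℕ => dist (T^[n] x) (T^[n] y)) Filter.atTop = 0 ∧
        0 < Filter.limsup (fun n : ℕ => dist (T^[n] x) (T^[n] y)) Filter.atTop := by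
  classical
  obtain ⟨p, ε, hε, hQ⟩ := LY_start T hent
  set Q : Bool → Set X := fun b : Bool =>
      if b then Metric.closedBall p (ε / 4) else (Metric.ball p (ε / 2))ᶜ with hQdef
  have hQsep : ∀ a b, a ≠ b → ∀ x ∈ Q a, ∀ y ∈ Q b, ε / 4 ≤ dist x y := by
    have key : ∀ x ∈ Q true, ∀ y ∈ Q false, ε / 4 ≤ dist x y := by
      intro x hx y hy
      simp only [hQdef, if_true, Bool.false_eq_true, if_false, Metric.mem_closedBall,
        Set.mem_compl_iff, Metric.mem_ball, not_lt] at hx hy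
      have := dist_triangle_left y p x
      linarith
    intro a b hab x hx y hy
    cases a <;> cases b
    · exact absurd rfl hab
    · rw [dist_comm]; exact key y hy x hx
    · exact key x hx y hy
    · exact absurd rfl hab
  have hQdisj : ∀ a b, a ≠ b → Disjoint (Q a) (Q b) := by
    intro a b hab
    rw [Set.disjoint_left]
    intro x hx hx'
    have := hQsep a b hab x hx x hx'
    rw [dist_self] at this
    linarith
  have hQclosed : ∀ b, IsClosed (Q b) := by
    intro b
    cases b
    · simp [hQdef, Metric.isOpen_ball]
    · simp [hQdef, Metric.isClosed_closedBall]
  have hQP : LYP T Q := hQ.toP hQdisj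
  have hbase : LYGood T Q 0 (fun u => Q (u 0)) := by
    refine ⟨fun u => hQclosed _, fun u => subset_rfl, fun u v huv => hQdisj _ _ fun h => huv ?_,
      hQP.reindex (fun u => u 0) (fun u => subset_rfl)⟩
    funext j
    rw [show j = 0 from Fin.fin_one_eq_zero j]
    exact h
  have hstep : ∀ n, ∀ A : {A // LYGood T Q n A}, ∃ A' : {A' // LYGood T Q (n + 1) A'},
      (∀ u, A'.1 u ⊆ A.1 (fun j => u j.castSucc)) ∧
      (∃ m ≥ n, ∀ u, ∀ x ∈ A'.1 u, T^[m] x ∈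
        Q (u ⟨(Nat.unpair n).1, by have := Nat.unpair_left_le n; omega⟩)) ∧
      (∃ m ≥ n, ∀ u v, ∀ x ∈ A'.1 u, ∀ y ∈ A'.1 v,
        dist (T^[m] x) (T^[m] y) ≤ 1 / ((n : ℝ) + 1)) := by
    rintro n ⟨A, hA⟩
    obtain ⟨A', h1, h2⟩ := LY_step T hT Q n A hA
      ⟨(Nat.unpair n).1, by have := Nat.unpair_left_le n; omega⟩ (1 / ((n : ℝ) + 1)) (by positivity)
    exact ⟨⟨A', h1⟩, h2⟩
  choose next hnext1 hnext2 hnext3 using hstep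
  let S : ∀ n, {A // LYGood T Q n A} := fun n =>
    Nat.rec (motive := fun n => {A // LYGood T Q n A}) ⟨_, hbase⟩ (fun n A => next n A) n
  have hS : ∀ n, S (n + 1) = next n (S n) := fun n => rfl
  have hpt : ∀ α : ℕ → Bool, ∃ x, ∀ n, x ∈ (S n).1 (fun j => α j) := by
    intro α
    have := IsCompact.nonempty_iInter_of_sequence_nonempty_isCompact_isClosed
      (fun n => (S n).1 (fun j => α j)) (by
        intro n
        simp only [hS]
        exact hnext1 n (S n) _) (fun n => (S n).2.pos.nonempty _)
      ((S 0).2.closed _).isCompact (fun n => (S n).2.closed _)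
    obtain ⟨x, hx⟩ := this
    exact ⟨x, fun n => Set.mem_iInter.1 hx n⟩
  choose x hx using hpt
  have hsep : ∀ α β, α ≠ β → ∃ᶠ n : ℕ in atTop, ε / 4 ≤ dist (T^[n] (x α)) (T^[n] (x β)) := by
    intro α β hab
    obtain ⟨i, hi⟩ := Function.ne_iff.1 hab
    rw [Filter.frequently_atTop]
    intro N
    obtain ⟨m, hm, h⟩ := hnext2 (Nat.pair i N) (S (Nat.pair i N))
    refine ⟨m, (Nat.right_le_pair i N).trans hm, ?_⟩
    have h1 := h _ _ (hx α (Nat.pair i N + 1))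
    have h2 := h _ _ (hx β (Nat.pair i N + 1))
    simp only [Nat.unpair_pair] at h1 h2
    exact hQsep _ _ hi _ h1 _ h2
  have hprox : ∀ α β, ∀ δ > 0, ∃ᶠ n : ℕ in atTop, dist (T^[n] (x α)) (T^[n] (x β)) ≤ δ := by
    intro α β δ hδ
    rw [Filter.frequently_atTop]
    intro N
    obtain ⟨k, hk⟩ := exists_nat_one_div_lt hδ
    obtain ⟨m, hm, h⟩ := hnext3 (max N k) (S (max N k))
    refine ⟨m, (le_max_left N k).trans hm, ?_⟩
    refine (h _ _ _ (hx α (max N k + 1)) _ (hx β (max N k + 1))).trans (le_trans ?_ hk.le)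
    have : (k : ℝ) ≤ ((max N k : ℕ) : ℝ) := by exact_mod_cast le_max_right N k
    gcongr
  have hinj : Function.Injective x := by
    intro α β h
    by_contra hab
    obtain ⟨n, hn⟩ := (hsep α β hab).exists
    rw [h, dist_self] at hn
    linarith
  have hbdd : ∀ y z : X, IsBoundedUnder (· ≤ ·) atTop (fun n : ℕ => dist (T^[n] y) (T^[n] z)) := by
    intro y z
    refine isBoundedUnder_of ⟨Metric.diam (Set.univ : Set X), fun n => ?_⟩
    exact Metric.dist_le_diam_of_mem isCompact_univ.isBounded trivial trivial
  have hbdd' : ∀ y z : X, IsBoundedUnder (· ≥ ·) atTop (fun n : ℕ => dist (T^[n] y) (T^[n] z)) :=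
    fun y z => isBoundedUnder_of ⟨0, fun n => dist_nonneg⟩
  refine ⟨Set.range x, ?_, ?_⟩
  · intro hc
    have h1 : (Set.univ : Set (ℕ → Bool)).Countable := by
      rw [← Set.image_univ] at hc
      exact Set.countable_of_injective_of_countable_image hinj.injOn hc
    have h2 : Countable (ℕ → Bool) := Set.countable_univ_iff.1 h1
    have h3 : Countable (Set ℕ) :=
      (Function.Injective.countable (f := fun s : Set ℕ => fun n => decide (n ∈ s)) (by
        intro s t hst
        ext n
        have := congrFun hst n
        simpa using this))
    obtain ⟨f, hf⟩ := h3.exists_injective_nat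
    exact Function.cantor_injective f hf
  · rintro _ ⟨α, rfl⟩ _ ⟨β, rfl⟩ hab
    have hab' : α ≠ β := fun h => hab (by rw [h])
    refine ⟨le_antisymm ?_ ?_, ?_⟩
    · refine le_of_forall_pos_le_add fun δ hδ => ?_
      rw [zero_add]
      exact liminf_le_of_frequently_le (hprox α β δ hδ) (hbdd' _ _)
    · exact le_liminf_of_le (hbdd _ _).isCoboundedUnder_ge (Eventually.of_forall fun n => dist_nonneg)
    · have : ε / 4 ≤ _ := le_limsup_of_frequently_le (hsep α β hab') (hbdd _ _)
      linarith
end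

section
/- Let (X, 𝔅, μ) be a probability space and let P be a finite measurable partition of X which is μ-roughly equal with parameters α > 0, n ∈ ℕ, h > 0. Fix 0 < β < α and h' > 0. Then there exist γ with 0 < γ < β and M ∈ ℕ such that for every m ≥ M and every finite measurable partition Q of X satisfying: Q is μ-roughly equal with parameters γ, m, h', and H_μ(P∨Q) > H_μ(P) + H_μ(Q) − γ, the following two conclusions hold: (1) P∨Q is μ-roughly equal with parameters α + β + γ, m, h'; (2) there is a collection of atoms A of P of total μ-measure at least 1 − α − β such that for each such A, Q is μ_A-roughly equal with parameters β, m, h'. -/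
open MeasureTheory ProbabilityTheory

/-- `P` is a finite measurable partition of `X` (indexed by a finite index type). -/
structure IsPartition {X : Type*} [MeasurableSpace X] {ι : Type*} (P : ι → Set X) : Prop where
  meas : ∀ i, MeasurableSet (P i)
  disj : Pairwise (Function.onFun Disjoint P)
  cover : ⋃ i, P i = Set.univ

/-- The Shannon entropy (base 2) of the probability vector of a finite partition `P`
with respect to `μ`.  (Note `Real.logb 2 0 = 0`, so the convention `0 · log 0 = 0` holds.) -/
noncomputable def entropyH {X : Type*} [MeasurableSpace X] {ι : Type*} [Fintype ι]
    (μ : Measure X) (P : ι → Set X) : ℝ :=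
  - ∑ i, (μ (P i)).toReal * Real.logb 2 (μ (P i)).toReal

open scoped Classical in
/-- The partition `P` is `μ`-roughly equal with parameters `ε, n, h`: the atoms whose measure
lies strictly between `2 ^ (-n (h + ε))` and `2 ^ (-n (h - ε))` (the "good" atoms) carry total
measure greater than `1 - ε`. -/
noncomputable def RoughlyEqual {X : Type*} [MeasurableSpace X] {ι : Type*} [Fintype ι]
    (μ : Measure X) (P : ι → Set X) (ε : ℝ) (n : ℕ) (h : ℝ) : Prop :=
  1 - ε < ∑ i ∈ Finset.univ.filter (fun i =>
      (2 : ℝ) ^ (-(n : ℝ) * (h + ε)) < (μ (P i)).toReal ∧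
      (μ (P i)).toReal < (2 : ℝ) ^ (-(n : ℝ) * (h - ε))), (μ (P i)).toReal

lemma aux_term (p q : ℝ) (hp : 0 ≤ p) (hq : 0 ≤ q) (hpq : q = 0 → p = 0) :
    (√p - √q) ^ 2 + p - q ≤ p * Real.log (p / q) := by
  rcases hp.eq_or_lt with h0 | h0
  · subst h0
    simp [Real.sq_sqrt hq]
  have hq0 : 0 < q := by
    rcases hq.eq_or_lt with h | h
    · have := hpq h.symm; linarith
    · exact h
  have hsp : 0 < √p := Real.sqrt_pos.2 h0
  have hsq : 0 < √q := Real.sqrt_pos.2 hq0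
  have h1 := Real.log_le_sub_one_of_pos (div_pos hsq hsp)
  have e1 : Real.log (√q / √p) = - Real.log (p / q) / 2 := by
    rw [Real.log_div hsq.ne' hsp.ne', Real.log_div h0.ne' hq0.ne', Real.log_sqrt hq,
      Real.log_sqrt hp]
    ring
  rw [e1] at h1
  have h2 : 2 - 2 * (√q / √p) ≤ Real.log (p / q) := by linarith
  have h3 := mul_le_mul_of_nonneg_left h2 hp
  have e2 : p * (2 - 2 * (√q / √p)) = 2 * p - 2 * √p * √q := by
    have : p * (√q / √p) = √p * √q := by
      field_simp
      rw [Real.sq_sqrt hp]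
    linarith
  have := Real.sq_sqrt hp
  have := Real.sq_sqrt hq
  nlinarith

lemma aux_pinsker {ι : Type*} [Fintype ι] (p q : ι → ℝ) (hp : ∀ i, 0 ≤ p i) (hq : ∀ i, 0 ≤ q i)
    (hpq : ∀ i, q i = 0 → p i = 0) (sp : ∑ i, p i = 1) (sq : ∑ i, q i = 1) :
    (∑ i, |p i - q i|) ^ 2 ≤ 4 * ∑ i, p i * Real.log (p i / q i) := by
  have h1 : ∑ i, (√(p i) - √(q i)) ^ 2 ≤ ∑ i, p i * Real.log (p i / q i) := by
    have := Finset.sum_le_sum (s := Finset.univ)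
      (fun i _ => aux_term (p i) (q i) (hp i) (hq i) (hpq i))
    rw [Finset.sum_sub_distrib, Finset.sum_add_distrib, sp, sq] at this
    linarith
  have h2 : ∑ i, (√(p i) + √(q i)) ^ 2 ≤ 4 := by
    calc ∑ i, (√(p i) + √(q i)) ^ 2 ≤ ∑ i, (2 * p i + 2 * q i) := by
          refine Finset.sum_le_sum fun i _ => ?_
          have := Real.sq_sqrt (hp i)
          have := Real.sq_sqrt (hq i)
          nlinarith [sq_nonneg (√(p i) - √(q i))]
      _ = 4 := by rw [Finset.sum_add_distrib, ← Finset.mul_sum, ← Finset.mul_sum, sp, sq]; norm_num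
  have h3 := Finset.sum_mul_sq_le_sq_mul_sq Finset.univ (fun i => |√(p i) - √(q i)|)
    (fun i => √(p i) + √(q i))
  have e : ∀ i, |√(p i) - √(q i)| * (√(p i) + √(q i)) = |p i - q i| := by
    intro i
    rw [← abs_of_nonneg (add_nonneg (Real.sqrt_nonneg (p i)) (Real.sqrt_nonneg (q i))), ← abs_mul]
    congr 1
    have := Real.sq_sqrt (hp i)
    have := Real.sq_sqrt (hq i)
    nlinarith
  simp only [e, sq_abs] at h3
  have h4 : 0 ≤ ∑ i, (√(p i) - √(q i)) ^ 2 := Finset.sum_nonneg fun i _ => sq_nonneg _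
  nlinarith

open scoped Classical in
lemma aux_transfer {κ : Type*} [Fintype κ] (r b : κ → ℝ) (hr : ∀ j, 0 ≤ r j)
    (β γ h' : ℝ) (m : ℕ) (hβ : 0 < β) (hγ : γ ≤ β / 2) (hm : 2 / β ≤ m)
    (hd : ∑ j, |r j - b j| ≤ β / 8)
    (hb : 1 - γ < ∑ j ∈ Finset.univ.filter (fun j =>
      (2 : ℝ) ^ (-(m : ℝ) * (h' + γ)) < b j ∧ b j < (2 : ℝ) ^ (-(m : ℝ) * (h' - γ))), b j) :
    1 - β < ∑ j ∈ Finset.univ.filter (fun j =>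
      (2 : ℝ) ^ (-(m : ℝ) * (h' + β)) < r j ∧ r j < (2 : ℝ) ^ (-(m : ℝ) * (h' - β))), r j := by
  have hm' : 2 ≤ m * β := by rwa [div_le_iff₀ hβ] at hm
  have hmg : 1 ≤ m * (β - γ) := by
    have : (m : ℝ) * (β / 2) ≤ m * (β - γ) := by
      apply mul_le_mul_of_nonneg_left _ (Nat.cast_nonneg m); linarith
    linarith
  have k1 : 2 * (2 : ℝ) ^ (-(m : ℝ) * (h' + β)) ≤ (2 : ℝ) ^ (-(m : ℝ) * (h' + γ)) := by
    rw [show ∀ t : ℝ, 2 * (2 : ℝ) ^ t = (2 : ℝ) ^ (1 + t) from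
      fun t => by rw [Real.rpow_add (by norm_num), Real.rpow_one]]
    exact Real.rpow_le_rpow_of_exponent_le (by norm_num) (by nlinarith)
  have k2 : 2 * (2 : ℝ) ^ (-(m : ℝ) * (h' - γ)) ≤ (2 : ℝ) ^ (-(m : ℝ) * (h' - β)) := by
    rw [show ∀ t : ℝ, 2 * (2 : ℝ) ^ t = (2 : ℝ) ^ (1 + t) from
      fun t => by rw [Real.rpow_add (by norm_num), Real.rpow_one]]
    exact Real.rpow_le_rpow_of_exponent_le (by norm_num) (by nlinarith)
  rw [Finset.sum_filter] at hb ⊢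
  have key := Finset.sum_le_sum (s := Finset.univ) (f := fun j =>
      (if (2 : ℝ) ^ (-(m : ℝ) * (h' + γ)) < b j ∧ b j < (2 : ℝ) ^ (-(m : ℝ) * (h' - γ))
        then b j else 0) - 3 * |r j - b j|) (g := fun j =>
      (if (2 : ℝ) ^ (-(m : ℝ) * (h' + β)) < r j ∧ r j < (2 : ℝ) ^ (-(m : ℝ) * (h' - β))
        then r j else 0)) ?_
  · rw [Finset.sum_sub_distrib, ← Finset.mul_sum] at key
    linarith
  · intro j _
    have hrj := hr j
    have ha := abs_nonneg (r j - b j)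
    have ha1 := neg_abs_le (r j - b j)
    have ha2 := le_abs_self (r j - b j)
    split_ifs with c1 c2 c2
    · linarith
    · by_contra hcon
      apply c2
      have p1 : (0 : ℝ) < (2 : ℝ) ^ (-(m : ℝ) * (h' + β)) := by positivity
      constructor <;> linarith
    · linarith
    · linarith

lemma aux_sum {X : Type*} [MeasurableSpace X] (μ : Measure X) [IsProbabilityMeasure μ]
    {l : ℕ} (Q : Fin l → Set X) (hQ : IsPartition Q) (A : Set X) (hA : MeasurableSet A) :
    ∑ j, (μ (A ∩ Q j)).toReal = (μ A).toReal := by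
  have : A = ⋃ j, A ∩ Q j := by rw [← Set.inter_iUnion, hQ.cover, Set.inter_univ]
  conv_rhs => rw [this]
  rw [measure_iUnion _ (fun j => hA.inter (hQ.meas j)), tsum_fintype,
    ENNReal.toReal_sum (fun _ _ => measure_ne_top _ _)]
  intro i j hij
  exact (hQ.disj hij).mono Set.inter_subset_right Set.inter_subset_right

lemma aux_min {l : ℕ} (a : Fin l → ℝ) (ha : ∀ i, 0 ≤ a i) :
    ∃ c : ℝ, 0 < c ∧ ∀ i, a i = 0 ∨ c ≤ a i := by
  classical
  by_cases hne : (Finset.univ.filter (fun i => a i ≠ 0)).Nonempty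
  · obtain ⟨i, hi, hmin⟩ := Finset.exists_min_image _ a hne
    refine ⟨a i, lt_of_le_of_ne (ha i) (by simpa [eq_comm] using hi), fun j => ?_⟩
    by_cases hj : a j = 0
    · exact Or.inl hj
    · exact Or.inr (hmin j (by simpa using hj))
  · refine ⟨1, one_pos, fun j => Or.inl ?_⟩
    by_contra hj
    exact hne ⟨j, by simpa using hj⟩

lemma aux_entropy {ι κ : Type*} [Fintype ι] [Fintype κ] (p : ι → κ → ℝ) (a : ι → ℝ) (b : κ → ℝ)
    (hp : ∀ i j, 0 ≤ p i j) (ha : ∀ i, ∑ j, p i j = a i) (hb : ∀ j, ∑ i, p i j = b j) :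
    ∑ x : ι × κ, p x.1 x.2 * Real.log (p x.1 x.2 / (a x.1 * b x.2)) =
      Real.log 2 * ((- ∑ i, a i * Real.logb 2 (a i)) + (- ∑ j, b j * Real.logb 2 (b j))
        - (- ∑ x : ι × κ, p x.1 x.2 * Real.logb 2 (p x.1 x.2))) := by
  have hl : Real.log 2 ≠ 0 := (Real.log_pos (by norm_num)).ne'
  have e : ∀ x : ι × κ, p x.1 x.2 * Real.log (p x.1 x.2 / (a x.1 * b x.2)) =
      p x.1 x.2 * Real.log (p x.1 x.2) - p x.1 x.2 * Real.log (a x.1)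
        - p x.1 x.2 * Real.log (b x.2) := by
    rintro ⟨i, j⟩
    rcases (hp i j).eq_or_lt with h | h
    · simp [← h]
    · have h1 : p i j ≤ a i := by
        rw [← ha i]; exact Finset.single_le_sum (fun j _ => hp i j) (Finset.mem_univ j)
      have h2 : p i j ≤ b j := by
        rw [← hb j]; exact Finset.single_le_sum (f := fun i => p i j) (fun i _ => hp i j) (Finset.mem_univ i)
      have h1' : a i ≠ 0 := by linarith
      have h2' : b j ≠ 0 := by linarith
      dsimp only
      rw [Real.log_div h.ne' (mul_ne_zero h1' h2'), Real.log_mul h1' h2']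
      ring
  have ea : ∑ x : ι × κ, p x.1 x.2 * Real.log (a x.1) = ∑ i, a i * Real.log (a i) := by
    rw [Fintype.sum_prod_type]
    refine Finset.sum_congr rfl fun i _ => ?_
    dsimp only
    rw [← Finset.sum_mul, ha]
  have eb : ∑ x : ι × κ, p x.1 x.2 * Real.log (b x.2) = ∑ j, b j * Real.log (b j) := by
    rw [Fintype.sum_prod_type_right]
    refine Finset.sum_congr rfl fun j _ => ?_
    dsimp only
    rw [← Finset.sum_mul, hb]
  simp only [e, Finset.sum_sub_distrib, ea, eb, Real.logb, mul_div_assoc', ← Finset.sum_div]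
  field_simp
  ring

/-- **Lemma 1 of the paper.** Let `P` be `μ`-roughly equal with parameters `α, n, h`, and fix
`0 < β < α` and `h' > 0`. Then there exist `0 < γ < β` and `M` such that whenever `m ≥ M` and
`Q` is a partition which is `μ`-roughly equal with parameters `γ, m, h'` and `γ`-independent
of `P` (i.e. `H_μ(P∨Q) > H_μ(P) + H_μ(Q) - γ`), then: (1) `P∨Q` is `μ`-roughly equal with
parameters `α + β + γ, m, h'`; and (2) on a collection of atoms of `P` of total measure at
least `1 - α - β`, the partition `Q` is roughly equal with parameters `β, m, h'` for the
conditional measure on the atom. -/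
theorem roughlyEqual_join_and_conditional {X : Type*} [MeasurableSpace X]
    (μ : Measure X) [IsProbabilityMeasure μ]
    {l : ℕ} (P : Fin l → Set X) (hPpart : IsPartition P)
    (α h : ℝ) (n : ℕ) (hα : 0 < α) (hh : 0 < h)
    (hP : RoughlyEqual μ P α n h)
    (β h' : ℝ) (hβ0 : 0 < β) (hβα : β < α) (hh' : 0 < h') :
    ∃ γ : ℝ, 0 < γ ∧ γ < β ∧ ∃ M : ℕ, ∀ m : ℕ, M ≤ m →
      ∀ (l' : ℕ) (Q : Fin l' → Set X), IsPartition Q →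
        RoughlyEqual μ Q γ m h' →
        entropyH μ (fun p : Fin l × Fin l' => P p.1 ∩ Q p.2) >
          entropyH μ P + entropyH μ Q - γ →
        (RoughlyEqual μ (fun p : Fin l × Fin l' => P p.1 ∩ Q p.2) (α + β + γ) m h' ∧
          ∃ G : Finset (Fin l), 1 - α - β ≤ ∑ i ∈ G, (μ (P i)).toReal ∧
            ∀ i ∈ G, RoughlyEqual (μ[|P i]) Q β m h') := by
  classical
  set a : Fin l → ℝ := fun i => (μ (P i)).toReal with ha
  have ha0 : ∀ i, 0 ≤ a i := fun i => ENNReal.toReal_nonneg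
  have ha1 : ∀ i, a i ≤ 1 := fun i => measureReal_le_one
  have hasum : ∑ i, a i = 1 := by
    simpa using aux_sum μ P hPpart Set.univ MeasurableSet.univ
  obtain ⟨c, hc0, hc⟩ := aux_min a ha0
  refine ⟨min (β / 2) ((c * β / 8) ^ 2 / 4), by positivity,
    lt_of_le_of_lt (min_le_left _ _) (by linarith), ?_⟩
  set γ := min (β / 2) ((c * β / 8) ^ 2 / 4) with hγ
  have hγ0 : 0 < γ := by positivity
  have hγ1 : γ ≤ β / 2 := min_le_left _ _
  have hγ2 : γ ≤ (c * β / 8) ^ 2 / 4 := min_le_right _ _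
  clear_value γ
  obtain ⟨M, hM⟩ := exists_nat_ge (max (2 / β) (- Real.logb 2 c / α))
  refine ⟨M, fun m hm l' Q hQ hQr hent => ?_⟩
  have hmM : (M : ℝ) ≤ m := by exact_mod_cast hm
  have hm1 : 2 / β ≤ m := (le_max_left _ _).trans (hM.trans hmM)
  have hm2 : - Real.logb 2 c / α ≤ m := (le_max_right _ _).trans (hM.trans hmM)
  have hcm : (2 : ℝ) ^ (-(m : ℝ) * α) ≤ c := by
    rw [div_le_iff₀ hα] at hm2
    calc (2 : ℝ) ^ (-(m : ℝ) * α) ≤ (2 : ℝ) ^ (Real.logb 2 c) :=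
          Real.rpow_le_rpow_of_exponent_le (by norm_num) (by linarith)
      _ = c := Real.rpow_logb (by norm_num) (by norm_num) hc0
  set p : Fin l → Fin l' → ℝ := fun i j => (μ (P i ∩ Q j)).toReal with hp
  set b : Fin l' → ℝ := fun j => (μ (Q j)).toReal with hb
  have hp0 : ∀ i j, 0 ≤ p i j := fun i j => ENNReal.toReal_nonneg
  have hb0 : ∀ j, 0 ≤ b j := fun j => ENNReal.toReal_nonneg
  have hpa : ∀ i, ∑ j, p i j = a i := fun i => aux_sum μ Q hQ (P i) (hPpart.meas i)
  have hpb : ∀ j, ∑ i, p i j = b j := fun j => by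
    refine Eq.trans ?_ (aux_sum μ P hPpart (Q j) (hQ.meas j))
    refine Finset.sum_congr rfl fun i _ => ?_
    simp only [hp]
    rw [Set.inter_comm]
  have hbsum : ∑ j, b j = 1 := by
    simpa using aux_sum μ Q hQ Set.univ MeasurableSet.univ
  have hle1 : ∀ i j, p i j ≤ a i := fun i j => by
    rw [← hpa i]; exact Finset.single_le_sum (fun j _ => hp0 i j) (Finset.mem_univ j)
  have hle2 : ∀ i j, p i j ≤ b j := fun i j => by
    rw [← hpb j]
    exact Finset.single_le_sum (f := fun i => p i j) (fun i _ => hp0 i j) (Finset.mem_univ i)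
  have hpin := aux_pinsker (fun x : Fin l × Fin l' => p x.1 x.2) (fun x => a x.1 * b x.2)
    (fun x => hp0 _ _) (fun x => mul_nonneg (ha0 _) (hb0 _))
    (fun x hx => by
      rcases mul_eq_zero.1 hx with h | h
      · exact le_antisymm (h ▸ hle1 x.1 x.2) (hp0 _ _)
      · exact le_antisymm (h ▸ hle2 x.1 x.2) (hp0 _ _))
    (by rw [Fintype.sum_prod_type]; simp only [hpa, hasum])
    (by rw [Fintype.sum_prod_type]; simp only [← Finset.mul_sum, hbsum, mul_one, hasum])
  rw [aux_entropy p a b hp0 hpa hpb] at hpin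
  have hent' : (- ∑ i, a i * Real.logb 2 (a i)) + (- ∑ j, b j * Real.logb 2 (b j))
        - (- ∑ x : Fin l × Fin l', p x.1 x.2 * Real.logb 2 (p x.1 x.2)) < γ := by
    simp only [entropyH] at hent
    simp only [ha, hb, hp]
    linarith
  have hlog1 : Real.log 2 < 1 := by linarith [Real.log_two_lt_d9]
  have hlog0 : 0 < Real.log 2 := Real.log_pos (by norm_num)
  have hL : ∑ x : Fin l × Fin l', |p x.1 x.2 - a x.1 * b x.2| ≤ c * β / 8 := by
    refine abs_le_of_sq_le_sq' ?_ (by positivity) |>.2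
    nlinarith
  have hcond : ∀ i j, ((μ[|P i]) (Q j)).toReal = p i j / a i := fun i j => by
    rw [cond_apply (hPpart.meas i), ENNReal.toReal_mul, ENNReal.toReal_inv]
    simp only [hp, ha]
    rw [div_eq_inv_mul]
  have hmain : ∀ i, a i ≠ 0 → RoughlyEqual (μ[|P i]) Q β m h' := by
    intro i hi
    have hci : c ≤ a i := (hc i).resolve_left hi
    have hai : 0 < a i := lt_of_lt_of_le hc0 hci
    unfold RoughlyEqual
    refine aux_transfer (fun j => ((μ[|P i]) (Q j)).toReal) b (fun j => ENNReal.toReal_nonneg)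
      β γ h' m hβ0 hγ1 hm1 ?_ hQr
    have e1 : ∑ j, |p i j - a i * b j| ≤ c * β / 8 := by
      refine le_trans ?_ hL
      rw [Fintype.sum_prod_type]
      exact Finset.single_le_sum (f := fun i => ∑ j, |p i j - a i * b j|)
        (fun i _ => Finset.sum_nonneg fun j _ => abs_nonneg _) (Finset.mem_univ i)
    have e2 : ∀ j, |((μ[|P i]) (Q j)).toReal - b j| = |p i j - a i * b j| / a i := fun j => by
      rw [hcond, ← abs_of_pos hai, ← abs_div, abs_of_pos hai]
      congr 1
      field_simp
    simp only [e2]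
    rw [← Finset.sum_div, div_le_iff₀ hai]
    nlinarith
  refine ⟨?_, Finset.univ.filter (fun i => a i ≠ 0), ?_, fun i hi => hmain i (by simpa using hi)⟩
  · have hstep : ∀ i, a i * (1 - β) ≤ ∑ j, if
        (2 : ℝ) ^ (-(m : ℝ) * (h' + (α + β + γ))) < p i j ∧
        p i j < (2 : ℝ) ^ (-(m : ℝ) * (h' - (α + β + γ))) then p i j else 0 := by
      intro i
      by_cases hi : a i = 0
      · rw [hi, zero_mul]
        refine Finset.sum_nonneg fun j _ => ?_
        split_ifs
        · exact hp0 i j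
        · exact le_rfl
      have hci : c ≤ a i := (hc i).resolve_left hi
      have hai : 0 < a i := lt_of_lt_of_le hc0 hci
      have h1 := hmain i hi
      unfold RoughlyEqual at h1
      rw [Finset.sum_filter] at h1
      simp only [hcond] at h1
      refine (mul_le_mul_of_nonneg_left h1.le hai.le).trans ?_
      rw [Finset.mul_sum]
      refine Finset.sum_le_sum fun j _ => ?_
      have hm0 : (0 : ℝ) ≤ m := Nat.cast_nonneg m
      split_ifs with c1 c2 c2
      · exact (mul_div_cancel₀ _ hi).le
      · exfalso
        apply c2
        obtain ⟨u, v⟩ := c1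
        rw [lt_div_iff₀ hai] at u
        constructor
        · refine lt_of_le_of_lt ?_ u
          calc (2 : ℝ) ^ (-(m : ℝ) * (h' + (α + β + γ)))
              ≤ (2 : ℝ) ^ (-(m : ℝ) * (h' + β) + -(m : ℝ) * α) :=
                Real.rpow_le_rpow_of_exponent_le (by norm_num) (by nlinarith)
            _ = (2 : ℝ) ^ (-(m : ℝ) * (h' + β)) * (2 : ℝ) ^ (-(m : ℝ) * α) :=
                Real.rpow_add (by norm_num) _ _
            _ ≤ _ := mul_le_mul_of_nonneg_left (hcm.trans hci) (by positivity)
        · have : p i j ≤ p i j / a i := le_div_self (hp0 i j) hai (ha1 i)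
          refine (this.trans_lt v).trans_le
            (Real.rpow_le_rpow_of_exponent_le (by norm_num) ?_)
          nlinarith
      · simpa using hp0 i j
      · simp
    have htot := Finset.sum_le_sum (s := Finset.univ) (fun i _ => hstep i)
    rw [← Finset.sum_mul, hasum, one_mul] at htot
    unfold RoughlyEqual
    rw [Finset.sum_filter, Fintype.sum_prod_type]
    refine lt_of_lt_of_le (by linarith : 1 - (α + β + γ) < 1 - β) (htot.trans (le_of_eq ?_))
    refine Finset.sum_congr rfl fun i _ => Finset.sum_congr rfl fun j _ => ?_
    simp only [hp]
  · have : ∑ i ∈ Finset.univ.filter (fun i => a i ≠ 0), a i = 1 := by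
      rw [Finset.sum_filter_ne_zero, hasum]
    have e : ∑ i ∈ Finset.univ.filter (fun i => a i ≠ 0), (μ (P i)).toReal = 1 := this
    linarith
end

section
/- Let (X, 𝔅, μ) be a standard Borel probability space and T : X → X an ergodic measure-preserving transformation with positive Kolmogorov–Sinai entropy h_μ(T) > 0, and let Π denote the Pinsker σ-algebra of (X, 𝔅, μ, T). Let P and Q be finite measurable partitions of X. Then for every ε > 0 there exists n > 1 such that for every m > n, H_μ(P | σ(Q^{[n,m−1]}) ∨ Π) > H_μ(P | Π) − ε, where σ(Q^{[n,m−1]}) is the σ-algebra generated by the partition Q^{[n,m−1]} = ⋁_{i=n}^{m−1} T^{−i}Q and ∨ denotes the join of σ-algebras. -/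
open MeasureTheory

/-- The dynamical join `⋁_{i=0}^{n-1} T⁻ⁱ P` of a finite partition `P` under the map `T`,
indexed by `P`-names of length `n`. -/
def dynJoin {X : Type*} (T : X → X) {l : ℕ} (P : Fin l → Set X) (n : ℕ)
    (f : Fin n → Fin l) : Set X :=
  ⋂ i : Fin n, T^[(i : ℕ)] ⁻¹' P (f i)

/-- The Kolmogorov–Sinai entropy of `(X, μ, T)`: the supremum over all finite measurable
partitions `P` of the limit of `(1/n) H_μ(⋁_{i=0}^{n-1} T⁻ⁱ P)` (the limit exists and is
expressed here as a `liminf`). -/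
noncomputable def ksEntropy {X : Type*} [MeasurableSpace X] (μ : Measure X) (T : X → X) :
    ENNReal :=
  ⨆ (l : ℕ) (P : Fin l → Set X) (_ : IsPartition P),
    ENNReal.ofReal (Filter.atTop.liminf fun n : ℕ => entropyH μ (dynJoin T P n) / n)

/-- The Pinsker σ-algebra of `(X, 𝔅, T)`: the join, over all finite measurable partitions `P`,
of the remote futures `Π_P = ⋂_{n ≥ 1} σ({T^{-m} A : m ≥ n, A ∈ P})`. -/
def pinskerAlgebra {X : Type*} [MeasurableSpace X] (T : X → X) : MeasurableSpace X :=
  ⨆ (l : ℕ) (P : Fin l → Set X) (_ : IsPartition P),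
    ⨅ (n : ℕ) (_ : 1 ≤ n), MeasurableSpace.generateFrom
      {S : Set X | ∃ m : ℕ, n ≤ m ∧ ∃ i : Fin l, S = T^[m] ⁻¹' P i}

/-- The conditional entropy `H_μ(P | 𝔉) = ∑_{A ∈ P} ∫ φ(μ[1_A | 𝔉]) dμ` of a finite
partition `P` given a σ-algebra `F`, where `φ(t) = -t log₂ t`. -/
noncomputable def condEntropyAlg {X : Type*} [MeasurableSpace X] (μ : Measure X)
    (F : MeasurableSpace X) {ι : Type*} [Fintype ι] (P : ι → Set X) : ℝ :=
  ∑ i, ∫ x, -((μ[(P i).indicator (fun _ => (1 : ℝ)) | F]) x *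
      Real.logb 2 ((μ[(P i).indicator (fun _ => (1 : ℝ)) | F]) x)) ∂μ

namespace CE
open Filter Topology
set_option linter.unusedSectionVars false
noncomputable def pr {X ι : Type*} {m0 : MeasurableSpace X} (μ : Measure X) (F : MeasurableSpace X)
    (f : X → ι) (i : ι) : X → ℝ :=
  μ[(f ⁻¹' {i}).indicator (fun _ => (1 : ℝ)) | F]

noncomputable def cH {X ι : Type*} {m0 : MeasurableSpace X} [Fintype ι] (μ : Measure X)
    (F : MeasurableSpace X) (f : X → ι) : ℝ :=
  ∑ i, ∫ x, Real.negMulLog (pr μ F f i x) ∂μ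

section basic
variable {X ι κ : Type*} {F G : MeasurableSpace X} [m0 : MeasurableSpace X] {μ : Measure X} [IsProbabilityMeasure μ]
  [Fintype ι] [MeasurableSpace ι] [MeasurableSingletonClass ι]
  [Fintype κ] [MeasurableSpace κ] [MeasurableSingletonClass κ]
  {f : X → ι} {g : X → κ}

lemma ind_int (hf : Measurable f) (i : ι) :
    Integrable ((f ⁻¹' {i}).indicator (fun _ => (1 : ℝ))) μ :=
  (integrable_const _).indicator (hf (measurableSet_singleton i))

lemma pr_mem (hF : F ≤ m0) (hf : Measurable f) (i : ι) :
    ∀ᵐ x ∂μ, pr μ F f i x ∈ Set.Icc (0:ℝ) 1 := by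
  refine (convex_Icc (0:ℝ) 1).condExp_mem hF (ind_int hf i) isClosed_Icc ?_
  refine Eventually.of_forall fun x => ?_
  by_cases h : x ∈ f ⁻¹' {i} <;> simp [h]

lemma pr_sm (i : ι) : StronglyMeasurable[F] (pr μ F f i) := stronglyMeasurable_condExp

lemma pr_sm' (hF : F ≤ m0) (i : ι) : StronglyMeasurable (pr μ F f i) :=
  stronglyMeasurable_condExp.mono hF

lemma int_of_cont (hF : F ≤ m0) (hf : Measurable f) (i : ι) {φ : ℝ → ℝ} (hφ : Continuous φ) :
    Integrable (fun x => φ (pr μ F f i x)) μ := by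
  obtain ⟨C, hC⟩ := isCompact_Icc.exists_bound_of_continuousOn (hφ.continuousOn (s := Set.Icc (0:ℝ) 1))
  refine Integrable.of_bound (C := C) (hφ.comp_stronglyMeasurable (pr_sm' hF i)).aestronglyMeasurable ?_
  filter_upwards [pr_mem hF hf i] with x hx using hC _ hx

lemma cH_nonneg (hF : F ≤ m0) (hf : Measurable f) : 0 ≤ cH μ F f := by
  refine Finset.sum_nonneg fun i _ => integral_nonneg_of_ae ?_
  filter_upwards [pr_mem hF hf i] with x hx using Real.negMulLog_nonneg hx.1 hx.2

lemma concave_aux : ConcaveOn ℝ (Set.Icc (0:ℝ) 1) (fun t => Real.negMulLog t + t^2/2) := by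
  have hd : ∀ x ∈ Set.Ioo (0:ℝ) 1, HasDerivAt (fun t => Real.negMulLog t + t^2/2) (-Real.log x - 1 + x) x := by
    intro x hx
    have h2 : HasDerivAt (fun t : ℝ => t^2/2) x x := by
      have := (hasDerivAt_pow 2 x).div_const 2
      simpa using this
    exact (Real.hasDerivAt_negMulLog hx.1.ne').add h2
  refine AntitoneOn.concaveOn_of_deriv (convex_Icc _ _) ?_ ?_ ?_
  · exact (Real.continuous_negMulLog.add (by fun_prop)).continuousOn
  · rw [interior_Icc]
    intro x hx
    exact (hd x hx).differentiableAt.differentiableWithinAt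
  · rw [interior_Icc]
    intro x hx y hy hxy
    rw [(hd x hx).deriv, (hd y hy).deriv]
    have h := Real.one_sub_inv_le_log_of_pos (div_pos hy.1 hx.1)
    rw [Real.log_div hy.1.ne' hx.1.ne', inv_div] at h
    have : y - x ≤ 1 - x / y := by
      rw [le_sub_iff_add_le, ← le_sub_iff_add_le', div_le_iff₀ hy.1]
      nlinarith [hx.1, hy.1, hx.2, hy.2, mul_nonneg (sub_nonneg.2 hxy) (sub_nonneg.2 hy.2.le)]
    linarith

lemma pr_tower (hFG : F ≤ G) (hG : G ≤ m0) (i : ι) :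
    μ[pr μ G f i | F] =ᵐ[μ] pr μ F f i := condExp_condExp_of_le hFG hG

lemma cross (hFG : F ≤ G) (hG : G ≤ m0) (hf : Measurable f) (i : ι) :
    ∫ x, pr μ F f i x * pr μ G f i x ∂μ = ∫ x, pr μ F f i x ^ 2 ∂μ := by
  have hF := hFG.trans hG
  have hint : Integrable (pr μ F f i * pr μ G f i) μ := by
    refine Integrable.of_bound (C := 1) ((pr_sm' hF i).mul (pr_sm' hG i)).aestronglyMeasurable ?_
    filter_upwards [pr_mem hF hf i, pr_mem hG hf i] with x hx hy
    simp only [Pi.mul_apply, Real.norm_eq_abs, abs_le]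
    constructor <;> nlinarith [hx.1, hx.2, hy.1, hy.2]
  have h := condExp_mul_of_stronglyMeasurable_left (m := F) (μ := μ) (pr_sm (F := F) i) hint integrable_condExp
  rw [show ∫ x, pr μ F f i x * pr μ G f i x ∂μ = ∫ x, (pr μ F f i * pr μ G f i) x ∂μ from rfl,
    ← integral_condExp (μ := μ) (f := pr μ F f i * pr μ G f i) hF]
  refine integral_congr_ae ?_
  filter_upwards [h, pr_tower (f := f) (μ := μ) hFG hG i] with x hx hy
  rw [hx]; simp only [Pi.mul_apply]; rw [hy]; ring

lemma sq_diff (hFG : F ≤ G) (hG : G ≤ m0) (hf : Measurable f) (i : ι) :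
    ∫ x, (pr μ G f i x - pr μ F f i x)^2 ∂μ = ∫ x, pr μ G f i x ^ 2 ∂μ - ∫ x, pr μ F f i x ^ 2 ∂μ := by
  have hF := hFG.trans hG
  have hint : Integrable (fun x => pr μ F f i x * pr μ G f i x) μ := by
    refine Integrable.of_bound (C := 1) ((pr_sm' hF i).mul (pr_sm' hG i)).aestronglyMeasurable ?_
    filter_upwards [pr_mem hF hf i, pr_mem hG hf i] with x hx hy
    simp only [Real.norm_eq_abs, abs_le]
    constructor <;> nlinarith [hx.1, hx.2, hy.1, hy.2]
  have h1 := int_of_cont (μ := μ) hF hf i (continuous_pow 2)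
  have h2 := int_of_cont (μ := μ) hG hf i (continuous_pow 2)
  have : ∀ x, (pr μ G f i x - pr μ F f i x)^2 = pr μ G f i x ^ 2 - 2 * (pr μ F f i x * pr μ G f i x) + pr μ F f i x ^ 2 := by
    intro x; ring
  simp_rw [this]
  have h3 : Integrable (fun x => pr μ G f i x ^ 2 - 2 * (pr μ F f i x * pr μ G f i x)) μ :=
    h2.sub (hint.const_mul 2)
  rw [integral_add h3 h1, integral_sub h2 (hint.const_mul 2), integral_const_mul,
    cross hFG hG hf i]
  ring

lemma gap (hFG : F ≤ G) (hG : G ≤ m0) (hf : Measurable f) (i : ι) :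
    (∫ x, (pr μ G f i x - pr μ F f i x)^2 ∂μ) / 2 ≤
      ∫ x, Real.negMulLog (pr μ F f i x) ∂μ - ∫ x, Real.negMulLog (pr μ G f i x) ∂μ := by
  have hF := hFG.trans hG
  have hc : Continuous (fun t => Real.negMulLog t + t^2/2) :=
    Real.continuous_negMulLog.add (by fun_prop)
  have hJ := concave_aux.condExp_map_le (f := pr μ G f i) (μ := μ) hF hc.continuousOn.upperSemicontinuousOn
    (pr_mem hG hf i) isClosed_Icc integrable_condExp (int_of_cont hG hf i hc)
  have hI : ∫ x, (Real.negMulLog (pr μ G f i x) + pr μ G f i x ^2/2) ∂μ ≤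
      ∫ x, (Real.negMulLog (pr μ F f i x) + pr μ F f i x ^2/2) ∂μ := by
    rw [← integral_condExp hF (f := fun x => (Real.negMulLog (pr μ G f i x) + pr μ G f i x ^2/2))]
    refine integral_mono_ae integrable_condExp (int_of_cont hF hf i hc) ?_
    filter_upwards [hJ, pr_tower (f := f) (μ := μ) hFG hG i] with x hx hy
    rw [Function.comp_apply, hy] at hx
    exact hx
  have a1 := int_of_cont (μ := μ) hF hf i Real.continuous_negMulLog
  have a2 := int_of_cont (μ := μ) hG hf i Real.continuous_negMulLog
  have b1 := int_of_cont (μ := μ) hF hf i (φ := fun t => t^2/2) (by fun_prop)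
  have b2 := int_of_cont (μ := μ) hG hf i (φ := fun t => t^2/2) (by fun_prop)
  rw [integral_add a1 b1, integral_add a2 b2, integral_div, integral_div] at hI
  rw [sq_diff hFG hG hf i]
  linarith

lemma cH_anti (hFG : F ≤ G) (hG : G ≤ m0) (hf : Measurable f) : cH μ G f ≤ cH μ F f := by
  refine Finset.sum_le_sum fun i _ => ?_
  have := gap (μ := μ) hFG hG hf i
  have h2 : 0 ≤ ∫ x, (pr μ G f i x - pr μ F f i x)^2 ∂μ := integral_nonneg fun x => sq_nonneg _
  linarith

lemma pr_eq_of_cH_le (hFG : F ≤ G) (hG : G ≤ m0) (hf : Measurable f) (h : cH μ F f ≤ cH μ G f) (i : ι) :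
    pr μ G f i =ᵐ[μ] pr μ F f i := by
  have hF := hFG.trans hG
  have h0 : ∀ i, 0 ≤ ∫ x, (pr μ G f i x - pr μ F f i x)^2 ∂μ := fun i => integral_nonneg fun x => sq_nonneg _
  have hs : ∑ i, (∫ x, (pr μ G f i x - pr μ F f i x)^2 ∂μ) / 2 ≤ 0 := by
    calc _ ≤ ∑ i, (∫ x, Real.negMulLog (pr μ F f i x) ∂μ - ∫ x, Real.negMulLog (pr μ G f i x) ∂μ) :=
          Finset.sum_le_sum fun i _ => gap hFG hG hf i
      _ = cH μ F f - cH μ G f := by rw [Finset.sum_sub_distrib]; rfl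
      _ ≤ 0 := by linarith
  have hz := (Finset.sum_eq_zero_iff_of_nonneg (fun i _ => div_nonneg (h0 i) zero_le_two)).1
    (le_antisymm hs (Finset.sum_nonneg fun i _ => div_nonneg (h0 i) zero_le_two)) i (Finset.mem_univ _)
  have hz' : ∫ x, (pr μ G f i x - pr μ F f i x)^2 ∂μ = 0 := by linarith
  have hint : Integrable (fun x => (pr μ G f i x - pr μ F f i x)^2) μ := by
    refine Integrable.of_bound (C := 1) (((pr_sm' hG i).sub (pr_sm' hF i)).pow 2).aestronglyMeasurable ?_
    filter_upwards [pr_mem hF hf i, pr_mem hG hf i] with x hx hy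
    simp only [Real.norm_eq_abs, abs_le]
    constructor <;> nlinarith [hx.1, hx.2, hy.1, hy.2]
  rw [integral_eq_zero_iff_of_nonneg (fun x => sq_nonneg _) hint] at hz'
  filter_upwards [hz'] with x hx
  have : pr μ G f i x - pr μ F f i x = 0 := by simpa using hx
  linarith

lemma cH_zero (hF : F ≤ m0) (hf : Measurable[F] f) : cH μ F f = 0 := by
  refine Finset.sum_eq_zero fun i _ => ?_
  have : pr μ F f i = (f ⁻¹' {i}).indicator (fun _ => (1 : ℝ)) := by
    refine condExp_of_stronglyMeasurable hF ?_ (ind_int (hf.mono hF le_rfl) i)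
    exact StronglyMeasurable.indicator (@stronglyMeasurable_const _ _ F _ _) (hf (measurableSet_singleton i))
  rw [this]
  refine integral_eq_zero_of_ae (Eventually.of_forall fun x => ?_)
  by_cases h : x ∈ f ⁻¹' {i} <;> simp [h]

lemma cH_tendsto (ℱ : Filtration ℕ m0) (hf : Measurable f) :
    Tendsto (fun n => cH μ (ℱ n) f) atTop (𝓝 (cH μ (⨆ n, ℱ n) f)) := by
  refine tendsto_finsetSum _ fun i _ => ?_
  obtain ⟨C, hC⟩ := isCompact_Icc.exists_bound_of_continuousOn
    (Real.continuous_negMulLog.continuousOn (s := Set.Icc (0:ℝ) 1))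
  refine tendsto_integral_of_dominated_convergence (fun _ => C) ?_ (integrable_const _) ?_ ?_
  · intro n
    exact (Real.continuous_negMulLog.comp_stronglyMeasurable (pr_sm' (ℱ.le n) i)).aestronglyMeasurable
  · intro n
    filter_upwards [pr_mem (ℱ.le n) hf i] with x hx using hC _ hx
  · filter_upwards [tendsto_ae_condExp (ℱ := ℱ) (μ := μ) ((f ⁻¹' {i}).indicator (fun _ => (1 : ℝ)))] with x hx
    exact (Real.continuous_negMulLog.tendsto _).comp hx

end basic
end CE

namespace CE
open Filter Topology
set_option linter.unusedSectionVars false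
section chain
variable {X ι κ : Type*} {F G : MeasurableSpace X} [m0 : MeasurableSpace X] {μ : Measure X} [IsProbabilityMeasure μ]
  [Fintype ι] [mι : MeasurableSpace ι] [MeasurableSingletonClass ι]
  [Fintype κ] [mκ : MeasurableSpace κ] [MeasurableSingletonClass κ]
  {f : X → ι} {g : X → κ}

lemma exists_trace (q : X → ℝ) (hq : StronglyMeasurable[F ⊔ mκ.comap g] q) (j : κ) :
    ∃ ρ : X → ℝ, StronglyMeasurable[F] ρ ∧ ∀ x, g x = j → ρ x = q x := by
  let v : {x // g x = j} → X := Subtype.val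
  have hc : (F ⊔ mκ.comap g).comap v = F.comap v := by
    rw [MeasurableSpace.comap_sup, MeasurableSpace.comap_comp]
    have : g ∘ v = fun _ => j := by funext x; exact x.2
    rw [this, MeasurableSpace.comap_const, sup_bot_eq]
  have hm : Measurable[F.comap v] (q ∘ v) := by
    rw [← hc]
    intro s hs
    exact ⟨q ⁻¹' s, hq.measurable hs, rfl⟩
  obtain ⟨ρ, hρ, he⟩ := @Measurable.exists_eq_measurable_comp _ _ _ F v (q ∘ v) _ _ _ hm
  refine ⟨ρ, hρ.stronglyMeasurable, fun x hx => ?_⟩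
  exact (congrFun he ⟨x, hx⟩).symm

lemma pr_sum (hF : F ≤ m0) (hf : Measurable f) (hg : Measurable g) (j : κ) :
    ∀ᵐ x ∂μ, ∑ i, pr μ F (fun x => (f x, g x)) (i, j) x = pr μ F g j x := by
  have h := condExp_finsetSum (μ := μ) (m := F) (s := Finset.univ) 
    (f := fun i : ι => ((fun x => (f x, g x)) ⁻¹' {(i, j)}).indicator (fun _ => (1 : ℝ)))
    (fun i _ => ind_int (hf.prodMk hg) (i, j))
  have he : (∑ i : ι, ((fun x => (f x, g x)) ⁻¹' {(i, j)}).indicator (fun _ => (1 : ℝ)))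
      = (g ⁻¹' {j}).indicator (fun _ => (1 : ℝ)) := by
    classical
    funext x
    simp [Finset.sum_apply, Set.indicator_apply, Prod.ext_iff]
    by_cases hx : g x = j <;> simp [hx, Finset.card_eq_one, Finset.filter_eq]
  rw [he] at h
  filter_upwards [h] with x hx
  rw [pr, hx, Finset.sum_apply]; rfl

lemma chain_aux (hF : F ≤ m0) (hf : Measurable f) (hg : Measurable g) (hGdef : G = F ⊔ mκ.comap g) :
    cH μ F (fun x => (f x, g x)) = cH μ F g + cH μ G f := by
  have hfg : Measurable (fun x => (f x, g x)) := hf.prodMk hg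
  have hFG : F ≤ G := hGdef ▸ le_sup_left
  have hgG0 : mκ.comap g ≤ G := hGdef ▸ le_sup_right
  have hG : G ≤ m0 := hGdef ▸ sup_le hF hg.comap_le
  have hex : ∀ i j, ∃ ρ : X → ℝ, StronglyMeasurable[F] ρ ∧ ∀ x, g x = j → ρ x = pr μ G f i x :=
    fun i j => exists_trace (pr μ G f i) (hGdef ▸ pr_sm (μ := μ) (F := G) (f := f) i) j
  choose ρ hρm hρe using hex
  have hgG : ∀ j, MeasurableSet[G] (g ⁻¹' {j}) := fun j =>
    hgG0 _ ⟨{j}, measurableSet_singleton j, rfl⟩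
  -- p_ij = ρ_ij p_j
  have key : ∀ i j, pr μ F (fun x => (f x, g x)) (i, j) =ᵐ[μ] fun x => ρ i j x * pr μ F g j x := by
    intro i j
    set I := (g ⁻¹' {j}).indicator (fun _ => (1 : ℝ)) with hI
    have e0 : ρ i j * I = (g ⁻¹' {j}).indicator (pr μ G f i) := by
      funext x
      by_cases hx : g x = j
      · simp [hI, hx, hρe i j x hx]
      · simp [hI, hx]
    have hint : Integrable (ρ i j * I) μ := by
      rw [e0]; exact integrable_condExp.indicator (hg (measurableSet_singleton j))
    have h1 := condExp_mul_of_stronglyMeasurable_left (μ := μ) (hρm i j) hint (ind_int hg j)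
    have h2 : μ[(g ⁻¹' {j}).indicator ((f ⁻¹' {i}).indicator (fun _ => (1 : ℝ))) | G] =ᵐ[μ]
      (g ⁻¹' {j}).indicator (pr μ G f i) := condExp_indicator (ind_int hf i) (hgG j)
    have h3 : (g ⁻¹' {j}).indicator ((f ⁻¹' {i}).indicator (fun _ => (1 : ℝ))) =
        ((fun x => (f x, g x)) ⁻¹' {(i, j)}).indicator (fun _ => (1 : ℝ)) := by
      classical
      funext x
      by_cases hx : g x = j <;> by_cases hy : f x = i <;> simp [Set.indicator_apply, hx, hy]
    rw [h3, ← e0] at h2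
    have h4 := condExp_congr_ae (m := F) h2
    have h5 := condExp_condExp_of_le (μ := μ) (f := ((fun x => (f x, g x)) ⁻¹' {(i, j)}).indicator (fun _ => (1 : ℝ))) hFG hG
    filter_upwards [h1, h4, h5] with x a b c
    rw [pr, ← c, b, a]; rfl
  -- sum over i
  have hsum : ∀ j, ∀ᵐ x ∂μ, ∑ i, Real.negMulLog (pr μ F (fun x => (f x, g x)) (i, j) x)
      = pr μ F g j x * (∑ i, Real.negMulLog (ρ i j x)) + Real.negMulLog (pr μ F g j x) := by
    intro j
    filter_upwards [pr_sum (μ := μ) hF hf hg j, ae_all_iff.2 fun i => key i j] with x h1 h2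
    have h3 : ∀ i, Real.negMulLog (pr μ F (fun x => (f x, g x)) (i, j) x) =
        pr μ F g j x * Real.negMulLog (ρ i j x) - pr μ F (fun x => (f x, g x)) (i, j) x * Real.log (pr μ F g j x) := by
      intro i
      rw [h2 i, Real.negMulLog_mul]
      simp only [Real.negMulLog]; ring
    simp_rw [h3]
    rw [Finset.sum_sub_distrib, ← Finset.mul_sum, ← Finset.sum_mul, h1]
    simp only [Real.negMulLog]; ring
  -- integral of the weighted term
  have hw : ∀ j, ∫ x, pr μ F g j x * (∑ i, Real.negMulLog (ρ i j x)) ∂μ =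
      ∫ x, (g ⁻¹' {j}).indicator (fun x => ∑ i, Real.negMulLog (pr μ G f i x)) x ∂μ := by
    intro j
    set I := (g ⁻¹' {j}).indicator (fun _ => (1 : ℝ)) with hI
    set Φ : X → ℝ := fun x => ∑ i, Real.negMulLog (ρ i j x) with hΦ
    have hΦm : StronglyMeasurable[F] Φ := by
      refine Finset.stronglyMeasurable_fun_sum _ fun i _ => ?_
      exact Real.continuous_negMulLog.comp_stronglyMeasurable (hρm i j)
    have e0 : I * Φ = (g ⁻¹' {j}).indicator (fun x => ∑ i, Real.negMulLog (pr μ G f i x)) := by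
      funext x
      by_cases hx : g x = j
      · simp [hI, hx, hΦ, fun i => hρe i j x hx]
      · simp [hI, hx]
    have hint : Integrable (I * Φ) μ := by
      rw [e0]
      exact (integrable_finsetSum _ fun i _ => int_of_cont hG hf i Real.continuous_negMulLog).indicator
        (hg (measurableSet_singleton j))
    have h1 := condExp_mul_of_stronglyMeasurable_right (μ := μ) hΦm hint (ind_int hg j)
    rw [← e0, ← integral_condExp hF (f := I * Φ)]
    refine integral_congr_ae ?_
    filter_upwards [h1] with x hx
    rw [hx]; rfl
  have hintj : ∀ j, Integrable (fun x => ∑ i, Real.negMulLog (pr μ F (fun x => (f x, g x)) (i, j) x)) μ :=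
    fun j => integrable_finsetSum _ fun i _ => int_of_cont hF hfg (i,j) Real.continuous_negMulLog
  have hj : ∀ j, ∑ i, ∫ x, Real.negMulLog (pr μ F (fun x => (f x, g x)) (i, j) x) ∂μ =
      ∫ x, Real.negMulLog (pr μ F g j x) ∂μ +
      ∫ x, (g ⁻¹' {j}).indicator (fun x => ∑ i, Real.negMulLog (pr μ G f i x)) x ∂μ := by
    intro j
    rw [← integral_finsetSum _ fun i _ => int_of_cont hF hfg (i,j) Real.continuous_negMulLog, ← hw j]
    have hi2 := int_of_cont (μ := μ) hF hg j Real.continuous_negMulLog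
    have hi1 : Integrable (fun x => pr μ F g j x * (∑ i, Real.negMulLog (ρ i j x))) μ := by
      refine ((hintj j).sub hi2).congr ?_
      filter_upwards [hsum j] with x hx
      rw [Pi.sub_apply, hx]; ring
    rw [integral_congr_ae (hsum j), integral_add hi1 hi2, add_comm]
  unfold cH
  rw [Fintype.sum_prod_type_right]
  simp_rw [hj]
  rw [Finset.sum_add_distrib]
  congr 1
  have hGi : Integrable (fun x => ∑ i, Real.negMulLog (pr μ G f i x)) μ :=
    integrable_finsetSum _ fun i _ => int_of_cont hG hf i Real.continuous_negMulLog
  rw [← integral_finsetSum _ fun j _ => hGi.indicator (hg (measurableSet_singleton j)),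
    ← integral_finsetSum _ fun i _ => int_of_cont hG hf i Real.continuous_negMulLog]
  refine integral_congr_ae (Eventually.of_forall fun x => ?_)
  classical
  simp [Set.indicator_apply]

lemma chain (hF : F ≤ m0) (hf : Measurable f) (hg : Measurable g) :
    cH μ F (fun x => (f x, g x)) = cH μ F g + cH μ (F ⊔ mκ.comap g) f :=
  chain_aux hF hf hg rfl

lemma cH_swap : cH μ F (fun x => (f x, g x)) = cH μ F (fun x => (g x, f x)) := by
  unfold cH
  refine Fintype.sum_equiv (Equiv.prodComm ι κ) _ _ fun ij => ?_
  have : pr μ F (fun x => (f x, g x)) ij = pr μ F (fun x => (g x, f x)) (Equiv.prodComm ι κ ij) := by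
    unfold pr
    congr 2
    ext x
    simp [Prod.ext_iff, and_comm]
  rw [this]

lemma cH_mono_fun (hF : F ≤ m0) (hf : Measurable f) (hg : Measurable g) (h : mι.comap f ≤ F ⊔ mκ.comap g) :
    cH μ F f ≤ cH μ F g := by
  have h1 := chain (μ := μ) hF hf hg
  have h2 := chain (μ := μ) hF hg hf
  rw [cH_swap] at h2
  have hG : F ⊔ mκ.comap g ≤ m0 := sup_le hF hg.comap_le
  have hG' : F ⊔ mι.comap f ≤ m0 := sup_le hF hf.comap_le
  have h3 : cH μ (F ⊔ mκ.comap g) f = 0 := cH_zero hG (measurable_iff_comap_le.2 h)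
  have h4 := cH_nonneg (μ := μ) hG' hg
  linarith

/-- flexible chain rule -/
lemma chain' {ν : Type*} [Fintype ν] [mν : MeasurableSpace ν] [MeasurableSingletonClass ν] {k : X → ν}
    (hF : F ≤ m0) (hf : Measurable f) (hg : Measurable g) (hk : Measurable k)
    (he : mν.comap k = mι.comap f ⊔ mκ.comap g) :
    cH μ F k = cH μ F g + cH μ (F ⊔ mκ.comap g) f := by
  rw [← chain hF hf hg]
  have hp : (MeasurableSpace.comap (fun x => (f x, g x)) inferInstance) = mι.comap f ⊔ mκ.comap g := 
    MeasurableSpace.comap_prodMk f g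
  refine le_antisymm (cH_mono_fun hF hk (hf.prodMk hg) ?_) (cH_mono_fun hF (hf.prodMk hg) hk ?_)
  · rw [hp, he]; exact le_sup_right
  · rw [hp, he]; exact le_sup_right

lemma pr_comp {T : X → X} (hT : MeasurePreserving T μ μ) (hF : F ≤ m0) (hf : Measurable f) (i : ι) :
    pr μ (F.comap T) (f ∘ T) i =ᵐ[μ] pr μ F f i ∘ T := by
  have hFT : F.comap T ≤ m0 := by
    rintro s ⟨t, ht, rfl⟩
    exact hT.measurable (hF _ ht)
  symm
  have hi : Integrable (pr μ F f i ∘ T) μ := hT.integrable_comp_of_integrable integrable_condExp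
  refine ae_eq_condExp_of_forall_setIntegral_eq hFT (ind_int (hf.comp hT.measurable) i) 
    (fun s _ _ => hi.integrableOn) ?_ ?_
  · rintro s ⟨t, ht, rfl⟩ -
    have h1 : ∀ u : X → ℝ, AEStronglyMeasurable u μ → ∫ x in T ⁻¹' t, u (T x) ∂μ = ∫ x in t, u x ∂μ := by
      intro u hu
      have hr := hT.restrict_preimage (hF _ ht)
      conv_rhs => rw [← hr.map_eq]
      rw [integral_map hT.measurable.aemeasurable]
      rw [hr.map_eq]; exact hu.restrict
    have h2 := h1 (pr μ F f i) integrable_condExp.aestronglyMeasurable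
    have h3 := h1 _ (ind_int (μ := μ) hf i).aestronglyMeasurable
    have h4 := setIntegral_condExp (μ := μ) hF (ind_int hf i) ht
    calc _ = _ := h2
      _ = _ := h4
      _ = _ := h3.symm
  · refine StronglyMeasurable.aestronglyMeasurable ?_
    refine Measurable.stronglyMeasurable ?_
    intro s hs
    exact ⟨_, (pr_sm (μ := μ) (f := f) (F := F) i).measurable hs, rfl⟩

lemma cH_comp {T : X → X} (hT : MeasurePreserving T μ μ) (hF : F ≤ m0) (hf : Measurable f) :
    cH μ (F.comap T) (f ∘ T) = cH μ F f := by
  unfold cH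
  refine Finset.sum_congr rfl fun i _ => ?_
  rw [integral_congr_ae (g := fun x => Real.negMulLog (pr μ F f i (T x)))]
  · have e := integral_map (μ := μ) (φ := T) hT.measurable.aemeasurable
      (f := fun x => Real.negMulLog (pr μ F f i x)) ?_
    · rw [hT.map_eq] at e
      exact e.symm
    rw [hT.map_eq]
    exact (Real.continuous_negMulLog.comp_stronglyMeasurable (pr_sm' hF i)).aestronglyMeasurable
  · filter_upwards [pr_comp hT hF hf i] with x hx
    rw [hx]; rfl

end chain
end CE

namespace CE
open Filter Topology
set_option linter.unusedSectionVars false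
section backward
variable {X ι : Type*} {F : ℕ → MeasurableSpace X} [m0 : MeasurableSpace X] {μ : Measure X} [IsProbabilityMeasure μ]
  [Fintype ι] [mι : MeasurableSpace ι] [MeasurableSingletonClass ι]
  {f : X → ι}

lemma lim_meas {Y : Type*} (G : MeasurableSpace Y) {g : ℕ → Y → ℝ} (hg : ∀ k, Measurable[G] (g k)) :
    Measurable[G] (fun x => limsup (fun k => g k x) atTop) :=
  Measurable.limsup hg

lemma backward_ae (hanti : Antitone F) (hF : ∀ n, F n ≤ m0) (hf : Measurable f) (i : ι) :
    ∃ ns : ℕ → ℕ, Tendsto ns atTop atTop ∧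
      ∀ᵐ x ∂μ, Tendsto (fun k => pr μ (F (ns k)) f i x) atTop (𝓝 (pr μ (⨅ n, F n) f i x)) := by
  set a : ℕ → ℝ := fun n => ∫ x, pr μ (F n) f i x ^ 2 ∂μ with ha
  have hsq : ∀ n m, n ≤ m → ∫ x, (pr μ (F n) f i x - pr μ (F m) f i x)^2 ∂μ = a n - a m :=
    fun n m h => sq_diff (hanti h) (hF n) hf i
  have haanti : Antitone a := by
    intro n m h
    have h2 : 0 ≤ ∫ x, (pr μ (F n) f i x - pr μ (F m) f i x)^2 ∂μ := integral_nonneg fun x => sq_nonneg _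
    rw [hsq n m h] at h2; linarith
  have hbdd : BddBelow (Set.range a) := ⟨0, by rintro _ ⟨n, rfl⟩; exact integral_nonneg fun x => sq_nonneg _⟩
  have hlim := tendsto_atTop_ciInf haanti hbdd
  set L := ⨅ n, a n
  have hLle : ∀ n, L ≤ a n := fun n => ciInf_le hbdd n
  have hns : ∀ k : ℕ, ∃ n, k ≤ n ∧ a n < L + (1/4)^k := by
    intro k
    have h1 := hlim.eventually (gt_mem_nhds (show L < L + (1/4:ℝ)^k by linarith [show (0:ℝ) < (1/4)^k by positivity]))
    obtain ⟨n, hn1, hn2⟩ := (h1.and (eventually_ge_atTop k)).exists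
    exact ⟨n, hn2, hn1⟩
  choose ns' hns1 hns2 using hns
  -- make it monotone
  set ns : ℕ → ℕ := fun k => (Finset.range (k+1)).sup ns' with hnsdef
  have hge : ∀ k, ns' k ≤ ns k := fun k => Finset.le_sup (f := ns') (by simp)
  have hmono : Monotone ns := fun k l h => Finset.sup_mono (by
    intro x hx; simp at hx ⊢; omega)
  have hk : ∀ k, k ≤ ns k := fun k => (hns1 k).trans (hge k)
  have hsmall : ∀ k, a (ns k) < L + (1/4)^k := fun k => (haanti (hge k)).trans_lt (hns2 k)
  have htop : Tendsto ns atTop atTop := tendsto_atTop_mono hk tendsto_id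
  refine ⟨ns, htop, ?_⟩
  have hdiffint : ∀ n m, Integrable (fun x => pr μ (F n) f i x - pr μ (F m) f i x) μ := fun n m =>
    integrable_condExp.sub integrable_condExp
  have hdiffint2 : ∀ n m, Integrable (fun x => (pr μ (F n) f i x - pr μ (F m) f i x)^2) μ := by
    intro n m
    refine Integrable.of_bound (C := 1) (((pr_sm' (hF n) i).sub (pr_sm' (hF m) i)).pow 2).aestronglyMeasurable ?_
    filter_upwards [pr_mem (hF n) hf i, pr_mem (hF m) hf i] with x hx hy
    simp only [Real.norm_eq_abs, abs_le]
    constructor <;> nlinarith [hx.1, hx.2, hy.1, hy.2]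
  have hL1 : ∀ N n m, N ≤ n → n ≤ m → 
      ∫ x, ‖pr μ (F (ns n)) f i x - pr μ (F (ns m)) f i x‖ ∂μ ≤ (1/2)^N := by
    intro N n m hN hnm
    have h1 : ∫ x, ‖pr μ (F (ns n)) f i x - pr μ (F (ns m)) f i x‖ ∂μ ≤
        ∫ x, ((1/2)^N / 2 + 2^N / 2 * (pr μ (F (ns n)) f i x - pr μ (F (ns m)) f i x)^2) ∂μ := by
      refine integral_mono (hdiffint _ _).norm ((integrable_const _).add ((hdiffint2 _ _).const_mul _)) ?_
      intro x
      simp only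
      set t := pr μ (F (ns n)) f i x - pr μ (F (ns m)) f i x
      rw [Real.norm_eq_abs, ← sq_abs t]
      have hp : (0:ℝ) < 2^N := by positivity
      have h2 : (1/2:ℝ)^N = 1 / 2^N := by rw [one_div_pow]
      rw [h2]
      have : 1 / 2^N / 2 + 2^N / 2 * |t|^2 - |t| = (2^N * |t| - 1)^2 / (2 * 2^N) := by field_simp; ring
      have h4 : 0 ≤ (2^N * |t| - 1)^2 / (2 * 2^N) := by positivity
      linarith
    rw [integral_add (integrable_const _) ((hdiffint2 _ _).const_mul _), integral_const_mul,
      hsq _ _ (hmono hnm)] at h1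
    simp only [integral_const, probReal_univ, smul_eq_mul, one_mul] at h1
    have h3 : a (ns n) - a (ns m) ≤ (1/4)^N := by
      have := hsmall N
      have := haanti (hmono hN)
      have := hLle (ns m)
      linarith
    have h5 : (2:ℝ)^N / 2 * (a (ns n) - a (ns m)) ≤ 2^N/2 * (1/4)^N := by gcongr
    have h6 : (2:ℝ)^N/2 * (1/4)^N = (1/2)^N/2 := by
      rw [div_mul_eq_mul_div, ← mul_pow]; norm_num
    linarith
  have hcau : ∀ᵐ x ∂μ, ∃ l : ℝ, Tendsto (fun k => pr μ (F (ns k)) f i x) atTop (𝓝 l) := by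
    refine Lp.ae_tendsto_of_cauchy_eLpNorm (p := 1) (B := fun N => ENNReal.ofReal (2 * (1/2)^N))
      (fun k => (pr_sm' (hF _) i).aestronglyMeasurable) le_rfl ?_ ?_
    · rw [← ENNReal.ofReal_tsum_of_nonneg (fun n => by positivity)]
      · exact ENNReal.ofReal_ne_top
      · exact (summable_geometric_of_lt_one (by norm_num) (by norm_num)).mul_left 2
    · have hw : ∀ N n m, N ≤ n → n ≤ m → eLpNorm (pr μ (F (ns n)) f i - pr μ (F (ns m)) f i) 1 μ
          < ENNReal.ofReal (2 * (1/2)^N) := by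
        intro N n m hN hnm
        rw [eLpNorm_one_eq_lintegral_enorm]
        simp only [Pi.sub_apply]
        rw [← ofReal_integral_norm_eq_lintegral_enorm (hdiffint _ _)]
        rw [ENNReal.ofReal_lt_ofReal_iff (by positivity)]
        refine (hL1 N n m hN hnm).trans_lt ?_
        have : (0:ℝ) < (1/2)^N := by positivity
        linarith
      intro N n m hn hm
      rcases le_total n m with h | h
      · exact hw N n m hn h
      · rw [eLpNorm_sub_comm]; exact hw N m n hm h
  set Lf : X → ℝ := fun x => limsup (fun k => pr μ (F (ns k)) f i x) atTop with hLf
  have hinf : (⨅ n, F n) ≤ m0 := (iInf_le F 0).trans (hF 0)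
  have hLm : StronglyMeasurable[⨅ n, F n] Lf := by
    suffices h : Measurable[⨅ n, F n] Lf from Measurable.stronglyMeasurable h
    intro s hs
    rw [MeasurableSpace.measurableSet_iInf]
    intro n
    have : Lf = fun x => limsup (fun k => pr μ (F (ns (k + n))) f i x) atTop := by
      funext x
      exact (limsup_nat_add (fun k => pr μ (F (ns k)) f i x) n).symm
    rw [this]
    have key : ∀ k, Measurable[F n] (pr μ (F (ns (k + n))) f i) := ?_
    · exact lim_meas (F n) key hs
    intro k
    have hle : F (ns (k+n)) ≤ F n := hanti ((Nat.le_add_left n k).trans (hk _))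
    exact (pr_sm (μ := μ) (F := F (ns (k+n))) (f := f) i).measurable.mono hle le_rfl
  have hLt : ∀ᵐ x ∂μ, Tendsto (fun k => pr μ (F (ns k)) f i x) atTop (𝓝 (Lf x)) := by
    filter_upwards [hcau] with x ⟨l, hl⟩
    rw [hLf]; simp only; rw [hl.limsup_eq]; exact hl
  have hb : ∀ k, ∀ᵐ x ∂μ, ‖pr μ (F (ns k)) f i x‖ ≤ 1 := by
    intro k
    filter_upwards [pr_mem (hF (ns k)) hf i] with x hx
    rw [Real.norm_eq_abs, abs_le]; constructor <;> linarith [hx.1, hx.2]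
  have hLint : Integrable Lf μ := by
    refine Integrable.of_bound (C := 1) (hLm.mono hinf).aestronglyMeasurable ?_
    filter_upwards [hLt, ae_all_iff.2 hb] with x hx hy
    exact le_of_tendsto hx.norm (Eventually.of_forall hy)
  have hEq : Lf =ᵐ[μ] pr μ (⨅ n, F n) f i := by
    refine ae_eq_condExp_of_forall_setIntegral_eq hinf (ind_int hf i) (fun s _ _ => hLint.integrableOn) ?_ 
      hLm.aestronglyMeasurable
    intro s hs _
    have h1 : Tendsto (fun k => ∫ x in s, pr μ (F (ns k)) f i x ∂μ) atTop (𝓝 (∫ x in s, Lf x ∂μ)) := by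
      refine tendsto_integral_of_dominated_convergence (fun _ => 1) 
        (fun k => (pr_sm' (hF _) i).aestronglyMeasurable) (integrable_const _) 
        (fun k => ae_restrict_of_ae (hb k)) (ae_restrict_of_ae hLt)
    have h2 : ∀ k, ∫ x in s, pr μ (F (ns k)) f i x ∂μ = ∫ x in s, (f ⁻¹' {i}).indicator (fun _ => (1 : ℝ)) x ∂μ := by
      intro k
      exact setIntegral_condExp (hF _) (ind_int hf i) (iInf_le F (ns k) _ hs)
    simp_rw [h2] at h1
    exact tendsto_nhds_unique h1 tendsto_const_nhds
  filter_upwards [hEq, hLt] with x h1 h2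
  rwa [← h1]

lemma cH_backward (hanti : Antitone F) (hF : ∀ n, F n ≤ m0) (hf : Measurable f) :
    Tendsto (fun n => cH μ (F n) f) atTop (𝓝 (cH μ (⨅ n, F n) f)) := by
  refine tendsto_finsetSum _ fun i _ => ?_
  obtain ⟨ns, hns, hae⟩ := backward_ae (μ := μ) hanti hF hf i
  have hmono : Monotone fun n => ∫ x, Real.negMulLog (pr μ (F n) f i x) ∂μ := by
    intro n m h
    have := gap (μ := μ) (hanti h) (hF n) hf i
    have h2 : 0 ≤ ∫ x, (pr μ (F n) f i x - pr μ (F m) f i x)^2 ∂μ := integral_nonneg fun x => sq_nonneg _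
    simp only
    linarith
  rw [tendsto_iff_tendsto_subseq_of_monotone hmono hns]
  obtain ⟨C, hC⟩ := isCompact_Icc.exists_bound_of_continuousOn
    (Real.continuous_negMulLog.continuousOn (s := Set.Icc (0:ℝ) 1))
  refine tendsto_integral_of_dominated_convergence (fun _ => C) ?_ (integrable_const _) ?_ ?_
  · intro n
    exact (Real.continuous_negMulLog.comp_stronglyMeasurable (pr_sm' (hF _) i)).aestronglyMeasurable
  · intro n
    filter_upwards [pr_mem (hF (ns n)) hf i] with x hx using hC _ hx
  · filter_upwards [hae] with x hx
    exact (Real.continuous_negMulLog.tendsto _).comp hx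

end backward
end CE

namespace CE
open Filter Topology
set_option linter.unusedSectionVars false
/-- σ-algebra generated by `f ∘ T^i`, `i ∈ s`. -/
@[reducible] def sg {X ι : Type*} [mι : MeasurableSpace ι] (T : X → X) (f : X → ι) (s : Set ℕ) : MeasurableSpace X :=
  ⨆ i ∈ s, mι.comap (f ∘ T^[i])

/-- block coding -/
def blk {X ι : Type*} (T : X → X) (f : X → ι) (n : ℕ) : X → (Fin n → ι) :=
  fun x k => f (T^[(k : ℕ)] x)

section alg
variable {X ι κ : Type*} [mι : MeasurableSpace ι] [mκ : MeasurableSpace κ] {T : X → X}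
  {f : X → ι} {g : X → κ}

lemma sg_mono {s t : Set ℕ} (h : s ⊆ t) : sg T f s ≤ sg T f t :=
  biSup_mono h

lemma sg_union (s t : Set ℕ) : sg T f (s ∪ t) = sg T f s ⊔ sg T f t := iSup_union

lemma sg_iUnion {α : Sort*} (s : α → Set ℕ) : sg T f (⋃ a, s a) = ⨆ a, sg T f (s a) := by
  unfold sg; rw [iSup_iUnion]

lemma sg_zero : sg T f {0} = mι.comap f := by simp [sg]

lemma sg_comap (s : Set ℕ) : (sg T f s).comap T = sg T f (Nat.succ '' s) := by
  unfold sg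
  rw [iSup_image, MeasurableSpace.comap_iSup]
  simp_rw [MeasurableSpace.comap_iSup, MeasurableSpace.comap_comp]
  rfl

lemma sg_prod (s : Set ℕ) : sg T (fun x => (f x, g x)) s = sg T f s ⊔ sg T g s := by
  unfold sg
  rw [← iSup_sup_eq]
  refine iSup_congr fun i => ?_
  rw [← iSup_sup_eq]
  refine iSup_congr fun _ => ?_
  exact MeasurableSpace.comap_prodMk (f ∘ T^[i]) (g ∘ T^[i])

lemma blk_comap (n : ℕ) : (MeasurableSpace.pi.comap (blk T f n)) = sg T f (Set.Iio n) := by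
  unfold MeasurableSpace.pi
  rw [MeasurableSpace.comap_iSup]
  simp_rw [MeasurableSpace.comap_comp]
  apply le_antisymm
  · refine iSup_le fun k => ?_
    exact le_iSup₂_of_le (k : ℕ) k.2 le_rfl
  · refine iSup₂_le fun i hi => ?_
    exact le_iSup_of_le (⟨i, hi⟩ : Fin n) le_rfl

lemma blkT_comap (n : ℕ) : (MeasurableSpace.pi.comap (blk T f n ∘ T)) = sg T f (Nat.succ '' Set.Iio n) := by
  rw [← MeasurableSpace.comap_comp, blk_comap, sg_comap]

lemma Iio_succ_eq (n : ℕ) : Set.Iio (n+1) = {0} ∪ Nat.succ '' Set.Iio n := by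
  ext k; cases k <;> simp

lemma succ_Ici (n : ℕ) : Nat.succ '' Set.Ici n = Set.Ici (n+1) := by
  ext k; cases k <;> simp

lemma blk_succ_comap (n : ℕ) : (MeasurableSpace.pi.comap (blk T f (n+1))) =
    mι.comap f ⊔ MeasurableSpace.pi.comap (blk T f n ∘ T) := by
  rw [blk_comap, blkT_comap, Iio_succ_eq, sg_union, sg_zero]

lemma sg_le [m0 : MeasurableSpace X] (hT : Measurable T) (hf : Measurable f) (s : Set ℕ) : sg T f s ≤ m0 :=
  iSup₂_le fun i _ => (hf.comp (hT.iterate i)).comap_le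

lemma blk_meas [m0 : MeasurableSpace X] (hT : Measurable T) (hf : Measurable f) (n : ℕ) : Measurable (blk T f n) :=
  measurable_pi_lambda _ fun k => hf.comp (hT.iterate k)

/-- if `ξ` is measurable for all futures of `S`, so is its orbit -/
lemma sg_le_tail (h : ∀ n, mκ.comap g ≤ sg T f (Set.Ici n)) (s : Set ℕ) (n : ℕ) :
    sg T g s ≤ sg T f (Set.Ici n) := by
  refine iSup₂_le fun i _ => ?_
  have key : ∀ i n, mκ.comap (g ∘ T^[i]) ≤ sg T f (Set.Ici n) := by
    intro i
    induction i with
    | zero => intro n; simpa using h n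
    | succ i ih =>
      intro n
      have h1 := MeasurableSpace.comap_mono (g := T) (ih n)
      rw [MeasurableSpace.comap_comp, sg_comap, succ_Ici] at h1
      exact h1.trans (sg_mono (Set.Ici_subset_Ici.2 (Nat.le_succ n)))
  exact key i n
end alg

section zero
variable {X ι : Type*} {F : MeasurableSpace X} [m0 : MeasurableSpace X] {μ : Measure X} [IsProbabilityMeasure μ]
  [Fintype ι] [mι : MeasurableSpace ι] [MeasurableSingletonClass ι] {T : X → X} {f : X → ι}

lemma cH_blk_zero (hF : F ≤ m0) : cH μ F (blk T f 0) = 0 :=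
  cH_zero hF (@measurable_of_subsingleton_codomain _ _ F _ _ _)
end zero

section dyn
variable {X ι κ : Type*} [m0 : MeasurableSpace X] {μ : Measure X} [IsProbabilityMeasure μ]
  [Fintype ι] [mι : MeasurableSpace ι] [MeasurableSingletonClass ι]
  [Fintype κ] [mκ : MeasurableSpace κ] [MeasurableSingletonClass κ]
  {T : X → X} {f : X → ι} {g : X → κ}

lemma cH_blk_succ (hT : MeasurePreserving T μ μ) (hf : Measurable f) (n : ℕ) :
    cH μ ⊥ (blk T f (n+1)) = cH μ ⊥ (blk T f n) + cH μ (sg T f (Nat.succ '' Set.Iio n)) f := by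
  have hb := blk_meas hT.measurable hf
  rw [chain' (μ := μ) bot_le hf ((hb n).comp hT.measurable) (hb (n+1)) (blk_succ_comap n), bot_sup_eq, blkT_comap]
  congr 1
  have := cH_comp (μ := μ) (F := ⊥) hT bot_le (hb n)
  rwa [MeasurableSpace.comap_bot] at this

lemma cH_blk_sum (hT : MeasurePreserving T μ μ) (hf : Measurable f) (n : ℕ) :
    cH μ ⊥ (blk T f n) = ∑ k ∈ Finset.range n, cH μ (sg T f (Nat.succ '' Set.Iio k)) f := by
  induction n with
  | zero => simp [cH_blk_zero bot_le]
  | succ n ih => rw [cH_blk_succ hT hf, ih, Finset.sum_range_succ]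

lemma ent_tendsto (hT : MeasurePreserving T μ μ) (hf : Measurable f) :
    Tendsto (fun n : ℕ => (n⁻¹ : ℝ) * cH μ ⊥ (blk T f n)) atTop (𝓝 (cH μ (sg T f (Set.Ici 1)) f)) := by
  simp_rw [cH_blk_sum hT hf]
  apply Filter.Tendsto.cesaro
  let ℱ : Filtration ℕ m0 := ⟨fun n => sg T f (Nat.succ '' Set.Iio n),
    fun a b h => sg_mono (Set.image_mono (Set.Iio_subset_Iio h)), fun n => sg_le hT.measurable hf _⟩
  have h := cH_tendsto (μ := μ) ℱ hf
  have e : (⨆ n, ℱ n) = sg T f (Set.Ici 1) := by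
    change (⨆ n, sg T f (Nat.succ '' Set.Iio n)) = _
    rw [← sg_iUnion, ← Set.image_iUnion]
    congr 1
    ext k; cases k
    · simp
    · simp
  rw [e] at h
  exact h

lemma cH_blk_fut (hT : MeasurePreserving T μ μ) (hf : Measurable f) (n : ℕ) :
    cH μ (sg T f (Set.Ici n)) (blk T f n) = n * cH μ (sg T f (Set.Ici 1)) f := by
  have hb := blk_meas hT.measurable hf
  have hs := sg_le hT.measurable hf
  induction n with
  | zero => simp [cH_blk_zero (hs _)]
  | succ n ih =>
    rw [chain' (μ := μ) (hs _) hf ((hb n).comp hT.measurable) (hb (n+1)) (blk_succ_comap n), blkT_comap, ← sg_union]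
    have := cH_comp (μ := μ) (F := sg T f (Set.Ici n)) hT (hs _) (hb n)
    rw [sg_comap, succ_Ici, ih] at this
    rw [this]
    have e : Set.Ici (n+1) ∪ Nat.succ '' Set.Iio n = Set.Ici 1 := by
      ext k; cases k
      · simp
      · simp; omega
    rw [e]; push_cast; ring

/-- zero entropy of remote-future functions -/
lemma ent_zero (hT : MeasurePreserving T μ μ) (hf : Measurable f) (hg : Measurable g)
    (h : ∀ n, mκ.comap g ≤ sg T f (Set.Ici n)) : cH μ (sg T g (Set.Ici 1)) g = 0 := by
  have hs := sg_le (T := T) hT.measurable hf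
  have hs' := sg_le (T := T) hT.measurable hg
  have hW : Measurable (fun x => (f x, g x)) := hf.prodMk hg
  have hc : ∀ n : ℕ, cH μ ⊥ (blk T g n) + n * cH μ (sg T f (Set.Ici 1)) f ≤
      cH μ ⊥ (blk T (fun x => (f x, g x)) n) := by
    intro n
    rw [chain' (μ := μ) bot_le (blk_meas hT.measurable hf n) (blk_meas hT.measurable hg n)
      (blk_meas hT.measurable hW n) (by rw [blk_comap, blk_comap, blk_comap, sg_prod]), bot_sup_eq, blk_comap,
      ← cH_blk_fut hT hf]
    gcongr
    exact cH_anti (sg_le_tail h _ _) (hs _) (blk_meas hT.measurable hf n)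
  have hWe : cH μ (sg T (fun x => (f x, g x)) (Set.Ici 1)) (fun x => (f x, g x)) = cH μ (sg T f (Set.Ici 1)) f := by
    rw [sg_prod, sup_eq_left.2 (sg_le_tail h _ _), cH_swap, chain (hs _) hg hf]
    rw [cH_zero (sup_le (hs _) hf.comap_le), add_zero]
    exact Measurable.mono (measurable_iff_comap_le.2 (h 1)) le_sup_left le_rfl
  have l1 := ent_tendsto (μ := μ) hT hW
  have l2 := ent_tendsto (μ := μ) hT hg
  rw [hWe] at l1
  have l3 := l1.sub l2
  have : cH μ (sg T f (Set.Ici 1)) f ≤ cH μ (sg T f (Set.Ici 1)) f - cH μ (sg T g (Set.Ici 1)) g := by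
    refine ge_of_tendsto l3 ?_
    filter_upwards [eventually_gt_atTop 0] with n hn
    have hn' : (0:ℝ) < n := by exact_mod_cast hn
    have := hc n
    rw [← mul_sub, inv_mul_eq_div, le_div_iff₀ hn']
    linarith
  exact le_antisymm (by linarith) (cH_nonneg (hs' _) hg)

lemma indep_tail (hT : MeasurePreserving T μ μ) (hf : Measurable f) (hg : Measurable g)
    (h0 : cH μ (sg T g (Set.Ici 1)) g = 0) (n : ℕ) :
    cH μ (sg T f (Set.Ici n)) (blk T f n) ≤ cH μ (sg T f (Set.Ici n) ⊔ sg T g Set.univ) (blk T f n) := by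
  have hs := sg_le (T := T) hT.measurable hf
  have hs' := sg_le (T := T) hT.measurable hg
  have hW : Measurable (fun x => (f x, g x)) := hf.prodMk hg
  have hsW := sg_le (T := T) hT.measurable hW
  have hent : cH μ (sg T f (Set.Ici 1)) f ≤ cH μ (sg T (fun x => (f x, g x)) (Set.Ici 1)) (fun x => (f x, g x)) := by
    refine le_of_tendsto_of_tendsto' (ent_tendsto (μ := μ) hT hf) (ent_tendsto (μ := μ) hT hW) fun n => ?_
    gcongr
    refine cH_mono_fun bot_le (blk_meas hT.measurable hf n) (blk_meas hT.measurable hW n) ?_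
    rw [blk_comap, blk_comap, sg_prod, bot_sup_eq]
    exact le_sup_left
  rw [cH_blk_fut hT hf]
  have e := cH_blk_fut (μ := μ) hT hW n
  rw [chain' (μ := μ) (hsW _) (blk_meas hT.measurable hf n) (blk_meas hT.measurable hg n)
      (blk_meas hT.measurable hW n) (by rw [blk_comap, blk_comap, blk_comap, sg_prod]), blk_comap, sg_prod,
      sup_assoc, ← sg_union, Set.Ici_union_Iio] at e
  have h1 : cH μ (sg T f (Set.Ici n) ⊔ sg T g (Set.Ici n)) (blk T g n) ≤ 0 := by
    refine (cH_anti (F := sg T g (Set.Ici n)) le_sup_right (sup_le (hs _) (hs' _)) (blk_meas hT.measurable hg n)).trans ?_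
    rw [cH_blk_fut hT hg, h0, mul_zero]
  have h2 : (n:ℝ) * cH μ (sg T f (Set.Ici 1)) f ≤ n * cH μ (sg T (fun x => (f x, g x)) (Set.Ici 1)) (fun x => (f x, g x)) := by
    gcongr
  linarith

end dyn
end CE

namespace CE
open Filter Topology
set_option linter.unusedSectionVars false
section pis
variable {X ι κ : Type*} {F G : MeasurableSpace X} [m0 : MeasurableSpace X] {μ : Measure X} [IsProbabilityMeasure μ]
  [Fintype ι] [mι : MeasurableSpace ι] [MeasurableSingletonClass ι]
  [Fintype κ] [mκ : MeasurableSpace κ] [MeasurableSingletonClass κ]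
  {f : X → ι} {g : X → κ}

lemma gen_inter (C : Set (Set X)) (hu : Set.univ ∈ C) (hG : G = F ⊔ MeasurableSpace.generateFrom C) :
    G = MeasurableSpace.generateFrom {s | ∃ A B, MeasurableSet[F] A ∧ B ∈ C ∧ s = A ∩ B} := by
  rw [hG]
  apply le_antisymm
  · refine sup_le ?_ ?_
    · intro A hA
      exact MeasurableSpace.measurableSet_generateFrom ⟨A, Set.univ, hA, hu, by simp⟩
    · refine MeasurableSpace.generateFrom_le fun B hB => ?_
      exact MeasurableSpace.measurableSet_generateFrom ⟨Set.univ, B, @MeasurableSet.univ _ F, hB, by simp⟩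
  · refine MeasurableSpace.generateFrom_le ?_
    rintro s ⟨A, B, hA, hB, rfl⟩
    refine @MeasurableSet.inter _ (F ⊔ MeasurableSpace.generateFrom C) _ _ ?_ ?_
    · exact (le_sup_left : F ≤ F ⊔ MeasurableSpace.generateFrom C) _ hA
    · exact (le_sup_right : MeasurableSpace.generateFrom C ≤ F ⊔ MeasurableSpace.generateFrom C) _
        (MeasurableSpace.measurableSet_generateFrom hB)

lemma pr_of_pi (C : Set (Set X)) (hu : Set.univ ∈ C) (hC : IsPiSystem C)
    (hGdef : G = F ⊔ MeasurableSpace.generateFrom C) (hG : G ≤ m0) (hf : Measurable f) (i : ι)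
    (h : ∀ A, MeasurableSet[F] A → ∀ B ∈ C, ∫ x in A ∩ B, pr μ F f i x ∂μ =
      ∫ x in A ∩ B, (f ⁻¹' {i}).indicator (fun _ => (1 : ℝ)) x ∂μ) :
    pr μ F f i =ᵐ[μ] pr μ G f i := by
  have hFG : F ≤ G := hGdef ▸ le_sup_left
  have hpi : IsPiSystem {s | ∃ A B, MeasurableSet[F] A ∧ B ∈ C ∧ s = A ∩ B} := by
    rintro _ ⟨A, B, hA, hB, rfl⟩ _ ⟨A', B', hA', hB', rfl⟩ hne
    refine ⟨A ∩ A', B ∩ B', @MeasurableSet.inter _ F _ _ hA hA', hC _ hB _ hB' (hne.mono ?_), ?_⟩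
    · rintro x ⟨⟨_, h1⟩, ⟨_, h2⟩⟩; exact ⟨h1, h2⟩
    · rw [Set.inter_inter_inter_comm]
  have hint : Integrable (pr μ F f i) μ := integrable_condExp
  have hint2 := ind_int (μ := μ) hf i
  have huniv : ∫ x, pr μ F f i x ∂μ = ∫ x, (f ⁻¹' {i}).indicator (fun _ => (1 : ℝ)) x ∂μ := by
    simpa using h Set.univ (@MeasurableSet.univ _ F) Set.univ hu
  refine ae_eq_condExp_of_forall_setIntegral_eq hG hint2 (fun s _ _ => hint.integrableOn) ?_
    ((pr_sm (F := F) i).mono hFG).aestronglyMeasurable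
  intro s hs _
  refine MeasurableSpace.induction_on_inter (m := G) (C := fun s _ => ∫ x in s, pr μ F f i x ∂μ =
      ∫ x in s, (f ⁻¹' {i}).indicator (fun _ => (1 : ℝ)) x ∂μ) (gen_inter C hu hGdef) hpi ?_ ?_ ?_ ?_ s hs
  · simp
  · rintro _ ⟨A, B, hA, hB, rfl⟩
    exact h A hA B hB
  · intro t ht hh
    have e1 := integral_add_compl (hG _ ht) hint
    have e2 := integral_add_compl (hG _ ht) hint2
    linarith
  · intro t hd ht hh
    rw [integral_iUnion (fun n => hG _ (ht n)) hd hint.integrableOn,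
      integral_iUnion (fun n => hG _ (ht n)) hd hint2.integrableOn]
    exact tsum_congr hh

lemma cH_sub_of_le (hFG : F ≤ G) (hG : G ≤ m0) (hf : Measurable f) (hg : Measurable g)
    (hgf : mκ.comap g ≤ mι.comap f) (h : cH μ F f ≤ cH μ G f) : cH μ F g ≤ cH μ G g := by
  have e : mι.comap f = mι.comap f ⊔ mκ.comap g := (sup_eq_left.2 hgf).symm
  have h1 := chain' (μ := μ) (hFG.trans hG) hf hg hf e
  have h2 := chain' (μ := μ) hG hf hg hf e
  have h3 : cH μ (G ⊔ mκ.comap g) f ≤ cH μ (F ⊔ mκ.comap g) f :=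
    cH_anti (sup_le_sup_right hFG _) (sup_le hG hg.comap_le) hf
  linarith
end pis

/-- sets in some remote future -/
def tailSets {X : Type*} [m0 : MeasurableSpace X] (T : X → X) : Set (Set X) :=
  {B | ∃ (ι : Type) (_ : Fintype ι) (_ : MeasurableSpace ι) (_ : MeasurableSingletonClass ι) (s : X → ι),
    Measurable s ∧ ∀ n, MeasurableSet[sg T s (Set.Ici n)] B}

section tail
variable {X ι κ : Type*} [m0 : MeasurableSpace X] {μ : Measure X} [IsProbabilityMeasure μ]
  [Fintype ι] [mι : MeasurableSpace ι] [MeasurableSingletonClass ι]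
  [Fintype κ] [mκ : MeasurableSpace κ] [MeasurableSingletonClass κ]
  {T : X → X} {f : X → ι} {g : X → κ}

lemma tail_univ : Set.univ ∈ tailSets T :=
  ⟨Unit, inferInstance, inferInstance, inferInstance, fun _ => (), measurable_const,
    fun n => @MeasurableSet.univ _ (sg T (fun _ => ()) (Set.Ici n))⟩

lemma tail_pi : IsPiSystem (tailSets T) := by
  rintro A ⟨ι, i1, i2, i3, s, hs, hA⟩ B ⟨κ, j1, j2, j3, t, ht, hB⟩ _
  refine ⟨ι × κ, inferInstance, inferInstance, inferInstance, fun x => (s x, t x), hs.prodMk ht, fun n => ?_⟩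
  rw [sg_prod]
  refine @MeasurableSet.inter _ (sg T s (Set.Ici n) ⊔ sg T t (Set.Ici n)) _ _ ?_ ?_
  · exact (le_sup_left : sg T s (Set.Ici n) ≤ sg T s (Set.Ici n) ⊔ sg T t (Set.Ici n)) _ (hA n)
  · exact (le_sup_right : sg T t (Set.Ici n) ≤ sg T s (Set.Ici n) ⊔ sg T t (Set.Ici n)) _ (hB n)

lemma tail_le (hT : Measurable T) : MeasurableSpace.generateFrom (tailSets T) ≤ m0 := by
  refine MeasurableSpace.generateFrom_le ?_
  rintro B ⟨ι, i1, i2, i3, s, hs, hB⟩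
  exact sg_le hT hs _ _ (hB 0)

lemma comap_mem_le {Y : Type*} (G : MeasurableSpace Y) {B : Set Y} (hB : MeasurableSet[G] B) :
    (inferInstance : MeasurableSpace Prop).comap (fun x => x ∈ B) ≤ G :=
  measurable_iff_comap_le.1 (measurable_mem.2 hB)

lemma mem_comap_meas {Y : Type*} (B : Set Y) :
    MeasurableSet[(inferInstance : MeasurableSpace Prop).comap (fun x => x ∈ B)] B :=
  ⟨{True}, trivial, by ext x; simp⟩

lemma set_int_tail (hT : MeasurePreserving T μ μ) (hf : Measurable f) (hg : Measurable g)
    (hgf : mκ.comap g ≤ mι.comap f) {n : ℕ} (hn : 1 ≤ n) (i : κ) (A : Set X)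
    (hA : MeasurableSet[sg T f (Set.Ici n)] A) (B : Set X) (hB : B ∈ tailSets T) :
    ∫ x in A ∩ B, pr μ (sg T f (Set.Ici n)) g i x ∂μ =
      ∫ x in A ∩ B, (g ⁻¹' {i}).indicator (fun _ => (1 : ℝ)) x ∂μ := by
  obtain ⟨ι', i1, i2, i3, s, hs, hB⟩ := hB
  have hBm : MeasurableSet B := sg_le hT.measurable hs _ _ (hB 0)
  have hξ : Measurable (fun x => x ∈ B) := measurable_mem.2 hBm
  have h0 := ent_zero (μ := μ) hT hs hξ (fun n => comap_mem_le _ (hB n))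
  have h1 := indep_tail (μ := μ) hT hf hξ h0 n
  have hG : sg T f (Set.Ici n) ⊔ sg T (fun x => x ∈ B) Set.univ ≤ m0 :=
    sup_le (sg_le hT.measurable hf _) (sg_le hT.measurable hξ _)
  have h2 := cH_sub_of_le (μ := μ) le_sup_left hG (blk_meas hT.measurable hf n) hg (by
    rw [blk_comap]
    refine hgf.trans ?_
    rw [← sg_zero (T := T)]
    exact sg_mono (by simp; omega)) h1
  have h3 := pr_eq_of_cH_le (μ := μ) le_sup_left hG hg h2 i
  have hAB : MeasurableSet[sg T f (Set.Ici n) ⊔ sg T (fun x => x ∈ B) Set.univ] (A ∩ B) := by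
    refine @MeasurableSet.inter _ (_) _ _ ?_ ?_
    · exact (le_sup_left : sg T f (Set.Ici n) ≤ _ ⊔ sg T (fun x => x ∈ B) Set.univ) _ hA
    · refine (le_sup_right : sg T (fun x => x ∈ B) Set.univ ≤ sg T f (Set.Ici n) ⊔ _) _ ?_
      refine sg_mono (Set.subset_univ {0}) _ ?_
      rw [sg_zero]
      exact mem_comap_meas B
  rw [← setIntegral_condExp hG (ind_int hg i) hAB]
  exact integral_congr_ae (ae_restrict_of_ae h3.symm)

lemma cH_tail (hT : MeasurePreserving T μ μ) (hf : Measurable f) (hg : Measurable g)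
    (hgf : mκ.comap g ≤ mι.comap f) {n : ℕ} (hn : 1 ≤ n) :
    cH μ (sg T f (Set.Ici n)) g = 
      cH μ (sg T f (Set.Ici n) ⊔ MeasurableSpace.generateFrom (tailSets T)) g := by
  unfold cH
  refine Finset.sum_congr rfl fun i _ => integral_congr_ae ?_
  have := pr_of_pi (μ := μ) (tailSets T) tail_univ tail_pi rfl 
    (sup_le (sg_le hT.measurable hf _) (tail_le hT.measurable)) hg i (set_int_tail hT hf hg hgf hn i)
  filter_upwards [this] with x hx
  rw [hx]

lemma sg_gen (p : X → ι) (s : Set ℕ) : sg T p s = MeasurableSpace.generateFrom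
    {S | ∃ m ∈ s, ∃ i, S = T^[m] ⁻¹' (p ⁻¹' {i})} := by
  apply le_antisymm
  · refine iSup₂_le fun m hm => ?_
    rintro _ ⟨t, _, rfl⟩
    have : (p ∘ T^[m]) ⁻¹' t = ⋃ i ∈ t, T^[m] ⁻¹' (p ⁻¹' {i}) := by ext x; simp
    rw [this]
    refine MeasurableSet.biUnion (Set.to_countable t) fun i _ => ?_
    exact MeasurableSpace.measurableSet_generateFrom ⟨m, hm, i, rfl⟩
  · refine MeasurableSpace.generateFrom_le ?_
    rintro _ ⟨m, hm, i, rfl⟩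
    refine (le_iSup₂_of_le m hm le_rfl : mι.comap (p ∘ T^[m]) ≤ sg T p s) _ ?_
    exact ⟨{i}, measurableSet_singleton i, rfl⟩

lemma sg_comp_le (φ : ι → κ) (s : Set ℕ) : sg T (φ ∘ f) s ≤ sg T f s := by
  refine iSup₂_mono fun m _ => ?_
  rw [Function.comp_assoc, ← MeasurableSpace.comap_comp, ← MeasurableSpace.comap_comp,
    ← MeasurableSpace.comap_comp]
  exact MeasurableSpace.comap_mono (MeasurableSpace.comap_mono (measurable_of_finite φ).comap_le)

end tail
end CE

namespace CE
open Filter Topology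

lemma exists_fun {X : Type*} [m0 : MeasurableSpace X] {l : ℕ} {P : Fin l → Set X} (hP : IsPartition P) :
    ∃ p : X → Fin l, Measurable p ∧ ∀ i, p ⁻¹' {i} = P i := by
  have h : ∀ x, ∃ i, x ∈ P i := fun x => by
    have : x ∈ ⋃ i, P i := by rw [hP.cover]; trivial
    simpa using this
  choose p hp using h
  have e : ∀ i, p ⁻¹' {i} = P i := by
    intro i
    ext x
    constructor
    · rintro rfl; exact hp x
    · intro hx
      by_contra hne
      exact Set.disjoint_left.1 (hP.disj (show p x ≠ i from hne)) (hp x) hx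
  exact ⟨p, measurable_to_countable' fun i => by rw [e]; exact hP.meas i, e⟩

lemma fun_part {X : Type*} [m0 : MeasurableSpace X] {l : ℕ} {r : X → Fin l} (hr : Measurable r) :
    IsPartition (fun i => r ⁻¹' {i}) where
  meas i := hr (measurableSet_singleton i)
  disj i j hij := by
    rw [Function.onFun, Set.disjoint_left]
    intro x hx hy
    exact hij (hx.symm.trans hy)
  cover := by ext x; simp

lemma gen_eq {X : Type*} [m0 : MeasurableSpace X] {T : X → X} {l : ℕ} {P : Fin l → Set X} {p : X → Fin l}
    (hp : ∀ i, p ⁻¹' {i} = P i) (n : ℕ) :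
    MeasurableSpace.generateFrom {S : Set X | ∃ m : ℕ, n ≤ m ∧ ∃ i : Fin l, S = T^[m] ⁻¹' P i} =
      sg T p (Set.Ici n) := by
  rw [sg_gen]
  simp_rw [hp]
  rfl

lemma pinsker_le_tail {X : Type*} [m0 : MeasurableSpace X] (T : X → X) :
    pinskerAlgebra T ≤ MeasurableSpace.generateFrom (tailSets T) := by
  refine iSup_le fun l => iSup_le fun P => iSup_le fun hP => ?_
  obtain ⟨p, hpm, hp⟩ := exists_fun hP
  intro B hB
  refine MeasurableSpace.measurableSet_generateFrom ?_
  refine ⟨Fin l, inferInstance, inferInstance, inferInstance, p, hpm, fun n => ?_⟩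
  have hB' := MeasurableSpace.measurableSet_iInf.1 (MeasurableSpace.measurableSet_iInf.1 hB (n+1)) (by omega)
  rw [gen_eq hp] at hB'
  exact sg_mono (Set.Ici_subset_Ici.2 (Nat.le_succ n)) _ hB'

lemma tail_le_pinsker {X : Type*} [m0 : MeasurableSpace X] (T : X → X) {l : ℕ} {r : X → Fin l} (hr : Measurable r) :
    (⨅ n, sg T r (Set.Ici n)) ≤ pinskerAlgebra T := by
  refine le_iSup_of_le l (le_iSup_of_le (fun i => r ⁻¹' {i}) (le_iSup_of_le (fun_part hr) ?_))
  refine le_iInf₂ fun n _ => ?_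
  rw [gen_eq (p := r) (fun i => rfl)]
  exact iInf_le _ n

lemma condEntropyAlg_eq {X : Type*} (F : MeasurableSpace X) [m0 : MeasurableSpace X] (μ : Measure X)
    {l : ℕ} {P : Fin l → Set X} {p : X → Fin l} (hp : ∀ i, p ⁻¹' {i} = P i) :
    condEntropyAlg μ F P = cH μ F p / Real.log 2 := by
  unfold condEntropyAlg cH pr
  rw [Finset.sum_div]
  refine Finset.sum_congr rfl fun i _ => ?_
  rw [← integral_div, hp]
  congr 1
  funext x
  simp only [Real.negMulLog, Real.logb]
  ring

lemma main_aux {X : Type*} [m0 : MeasurableSpace X] {μ : Measure X} [IsProbabilityMeasure μ] {T : X → X}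
    (hT : MeasurePreserving T μ μ) {l l' : ℕ} {p : X → Fin l} {q : X → Fin l'} (hp : Measurable p)
    (hq : Measurable q) {ε : ℝ} (hε : 0 < ε) :
    ∃ n : ℕ, 1 < n ∧ ∀ C : Set (Set X), MeasurableSpace.generateFrom C ≤ sg T q (Set.Ici n) →
      cH μ (MeasurableSpace.generateFrom C ⊔ pinskerAlgebra T) p > cH μ (pinskerAlgebra T) p - ε := by
  obtain ⟨r, hr, φ, ψ, hφ, hψ⟩ : ∃ r : X → Fin (l * l'), Measurable r ∧ ∃ (φ : Fin (l * l') → Fin l)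
      (ψ : Fin (l * l') → Fin l'), φ ∘ r = p ∧ ψ ∘ r = q := by
    refine ⟨fun x => finProdFinEquiv (p x, q x), (measurable_of_finite _).comp (hp.prodMk hq),
      fun k => (finProdFinEquiv.symm k).1, fun k => (finProdFinEquiv.symm k).2, ?_, ?_⟩ <;>
    · funext x; simp only [Function.comp, Equiv.symm_apply_apply]
  have hpr : MeasurableSpace.comap p inferInstance ≤ MeasurableSpace.comap r inferInstance := by
    rw [← hφ, ← MeasurableSpace.comap_comp]
    exact MeasurableSpace.comap_mono (measurable_of_finite φ).comap_le
  have hPi : pinskerAlgebra T ≤ m0 := (pinsker_le_tail T).trans (tail_le hT.measurable)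
  have hlim := cH_backward (μ := μ) (F := fun n => sg T r (Set.Ici n))
    (fun a b h => sg_mono (Set.Ici_subset_Ici.2 h)) (fun n => sg_le hT.measurable hr _) hp
  have h1 := cH_anti (μ := μ) (tail_le_pinsker T hr) hPi hp
  obtain ⟨n, hn1, hn2⟩ := ((hlim.eventually (lt_mem_nhds (sub_lt_self _ hε))).and (eventually_gt_atTop 1)).exists
  have key : cH μ (sg T r (Set.Ici n) ⊔ MeasurableSpace.generateFrom (tailSets T)) p >
      cH μ (pinskerAlgebra T) p - ε := by
    rw [← cH_tail hT hr hp hpr hn2.le]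
    linarith
  refine ⟨n, hn2, fun C hH => ?_⟩
  have hle : MeasurableSpace.generateFrom C ⊔ pinskerAlgebra T ≤ sg T r (Set.Ici n) ⊔ MeasurableSpace.generateFrom (tailSets T) := by
    refine sup_le_sup (hH.trans ?_) (pinsker_le_tail T)
    rw [← hψ]
    exact sg_comp_le ψ _
  have h2 := cH_anti (μ := μ) hle (sup_le (sg_le hT.measurable hr _) (tail_le hT.measurable)) hp
  exact lt_of_lt_of_le key h2

end CE

/-- **Lemma 2 of the paper.** Let `(X, 𝔅, μ, T)` be an ergodic system with positive entropy,
`Π` its Pinsker σ-algebra, and `P`, `Q` finite measurable partitions. Then for every `ε > 0`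
there exists `n > 1` such that for every `m > n`,
`H_μ(P | σ(Q^{[n,m-1]}) ∨ Π) > H_μ(P | Π) - ε`. -/
theorem condEntropy_pinsker_join {X : Type*} [MeasurableSpace X] [StandardBorelSpace X]
    (μ : Measure X) [IsProbabilityMeasure μ] (T : X → X)
    (herg : Ergodic T μ) (hent : 0 < ksEntropy μ T)
    {l l' : ℕ} (P : Fin l → Set X) (Q : Fin l' → Set X)
    (hP : IsPartition P) (hQ : IsPartition Q)
    (ε : ℝ) (hε : 0 < ε) :
    ∃ n : ℕ, 1 < n ∧ ∀ m : ℕ, n < m →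
      condEntropyAlg μ
          (MeasurableSpace.generateFrom
            {S : Set X | ∃ i : ℕ, n ≤ i ∧ i < m ∧ ∃ j : Fin l', S = T^[i] ⁻¹' Q j}
            ⊔ pinskerAlgebra T) P
        > condEntropyAlg μ (pinskerAlgebra T) P - ε := by
  obtain ⟨p, hpm, hp⟩ := CE.exists_fun hP
  obtain ⟨q, hqm, hq⟩ := CE.exists_fun hQ
  have hlog : 0 < Real.log 2 := Real.log_pos (by norm_num)
  obtain ⟨n, hn, h⟩ := CE.main_aux herg.toMeasurePreserving hpm hqm (mul_pos hε hlog)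
  refine ⟨n, hn, fun m _ => ?_⟩
  rw [CE.condEntropyAlg_eq _ μ hp, CE.condEntropyAlg_eq _ μ hp, gt_iff_lt, ← sub_pos]
  have h1 := h {S : Set X | ∃ i : ℕ, n ≤ i ∧ i < m ∧ ∃ j : Fin l', S = T^[i] ⁻¹' Q j} (by
    rw [← CE.gen_eq hq]
    refine MeasurableSpace.generateFrom_mono ?_
    rintro S ⟨i, hi, _, j, rfl⟩
    exact ⟨i, hi, j, rfl⟩)
  rw [show ∀ a b : ℝ, a / Real.log 2 - (b / Real.log 2 - ε) = (a - (b - ε * Real.log 2)) / Real.log 2 from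
    fun a b => by field_simp]
  exact div_pos (sub_pos.2 h1) hlog
end
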